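/- Let N ≥ 1, m ≥ 1, N/(N+m) < p ≤ 1, γ_p := N(1/p − 1), and fix an integer L > N(1/p − 1). There exists c > 0 such that for every f ∈ C_c^∞(ℝ^N), every α > 0 and every ε > 0 there exist: a measurable function g with |g| ≤ cα almost everywhere; finitely many C^m functions β_1,…,β_M, each β_k supported in a closed cube Q_k^* with sides parallel to the axes contained in {x : 𝓜f(x) > α}, with ∫ x^γ β_k(x) dx = 0 for all multi-indices |γ| ≤ m−1 and ∫_{ℝ^N}(sup_{t>0}|(β_k ∗ φ₀,ₜ)(x)|)^p dx ≤ c ∫_{Q_k^*}(𝓜f)^p dx, the cubes Q_1^*,…,Q_M^* having the bounded intersection property (no point in more than c of them); and a function ρ with f = g + Σ_{k=1}^M β_k + ρ and ‖ρ‖_{Λ^{γ_p}} ≤ ε when p < 1 (respectively ‖ρ‖_{bmo} ≤ ε when p = 1). -/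

import Mathlib

open MeasureTheory Set Metric Filter
open scoped ENNReal NNReal Topology

noncomputable section

abbrev RN (N : ℕ) := EuclideanSpace ℝ (Fin N)

variable {N : ℕ}

/-- Partial derivative in the `i`-th coordinate direction. -/
def pd {E : Type*} [NormedAddCommGroup E] [NormedSpace ℝ E] (i : Fin N)
    (f : RN N → E) : RN N → E :=
  fun x => fderiv ℝ f x (EuclideanSpace.single i 1)

/-- Multi-index partial derivative `∂^α`. -/
def md {E : Type*} [NormedAddCommGroup E] [NormedSpace ℝ E] (α : Fin N → ℕ)
    (f : RN N → E) : RN N → E :=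
  ((List.ofFn fun i : Fin N => (pd i)^[α i]).foldr (· ∘ ·) id) f

/-- Order `|α|` of a multi-index. -/
def mOrder (α : Fin N → ℕ) : ℕ := ∑ i, α i

/-- Multi-indices of order at most `k`. -/
def idxLe (N k : ℕ) : Finset (Fin N → ℕ) :=
  (Fintype.piFinset fun _ : Fin N => Finset.range (k + 1)).filter fun α => mOrder α ≤ k

/-- Multi-indices of order exactly `k`. -/
def idxEq (N k : ℕ) : Finset (Fin N → ℕ) :=
  (Fintype.piFinset fun _ : Fin N => Finset.range (k + 1)).filter fun α => mOrder α = k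

/-- The dilate `φ_t(z) = t^{-N} φ(z/t)`. -/
def dil (φ : RN N → ℝ) (t : ℝ) (z : RN N) : ℝ := φ (t⁻¹ • z) / t ^ N

/-- Convolution `(u * φ_t)(x)`. -/
def convAt (φ : RN N → ℝ) (t : ℝ) (u : RN N → ℂ) (x : RN N) : ℂ :=
  ∫ y, dil φ t (x - y) • u y

/-- The small maximal function `sup_{0<t<1} |(u * φ_t)(x)|`. -/
def smallMax (φ : RN N → ℝ) (u : RN N → ℂ) (x : RN N) : ℝ≥0∞ :=
  ⨆ t ∈ Ioo (0 : ℝ) 1, ENNReal.ofReal ‖convAt φ t u x‖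

/-- The localizable Hardy space quasi-norm `‖u‖_{h^p}` (for `0 < p < ∞`). -/
def hNorm (φ : RN N → ℝ) (p : ℝ) (u : RN N → ℂ) : ℝ≥0∞ :=
  (∫⁻ x, smallMax φ u x ^ p) ^ (1 / p)

/-- A fixed radial nonnegative smooth function supported in the unit ball with integral 1. -/
structure GoodPhi (φ : RN N → ℝ) : Prop where
  smooth : ContDiff ℝ (⊤ : ℕ∞) φ
  nonneg : ∀ x, 0 ≤ φ x
  radial : ∀ x y : RN N, ‖x‖ = ‖y‖ → φ x = φ y
  supp : tsupport φ ⊆ closedBall 0 1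
  int_one : ∫ x, φ x = 1

/-- The closed axes-parallel cube with center `c` and side length `ℓ`. -/
def cube (c : RN N) (ℓ : ℝ) : Set (RN N) := {y | ∀ i, |y i - c i| ≤ ℓ / 2}

/-- The open axes-parallel cube with center `c` and side length `ℓ`
(the interior of `cube c ℓ` when `ℓ > 0`). -/
def openCube (c : RN N) (ℓ : ℝ) : Set (RN N) := {y | ∀ i, |y i - c i| < ℓ / 2}

/-- `P` is a (complex) polynomial in `N` variables of degree at most `d`. -/
def IsPolyDegLE (N d : ℕ) (P : RN N → ℂ) : Prop :=
  ∃ c : (Fin N → ℕ) → ℂ, ∀ x : RN N, P x = ∑ α ∈ idxLe N d, c α * ∏ i, ((x i : ℝ) : ℂ) ^ α i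

/-- The family `𝓕_L(y,s)` of normalized bump functions supported in `B(y,s)`. -/
def calF (L : ℕ) (y : RN N) (s : ℝ) : Set (RN N → ℝ) :=
  {ψ | ContDiff ℝ (⊤ : ℕ∞) ψ ∧ HasCompactSupport ψ ∧ tsupport ψ ⊆ ball y s ∧
    ∀ α : Fin N → ℕ, mOrder α ≤ L → ∀ z, |md α ψ z| ≤ (s ^ (N + mOrder α))⁻¹}

/-- The grand maximal function `𝓜f(x) = sup { |∫ fψ| : ψ ∈ 𝓕_L(x,t), t > 0 }`. -/
def grandMax (L : ℕ) (f : RN N → ℂ) (x : RN N) : ℝ≥0∞ :=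
  ⨆ (t : ℝ) (_ : 0 < t) (ψ : RN N → ℝ) (_ : ψ ∈ calF L x t),
    ENNReal.ofReal ‖∫ z, ψ z • f z‖

/-- `Σ_{|α| = i} ‖∂^α f‖_{L^∞}` (as a supremum). -/
def supDeriv (i : ℕ) (f : RN N → ℂ) : ℝ :=
  ∑ α ∈ idxEq N i, ⨆ z : RN N, ‖md α f z‖

/-- The Hölder–Zygmund seminorm `[f]_γ`, writing `γ = k + s` with `k ∈ ℕ`, `0 < s ≤ 1`. -/
def hzSemi (γ : ℝ) (f : RN N → ℂ) : ℝ :=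
  if γ - ((⌈γ⌉₊ - 1 : ℕ) : ℝ) = 1 then
    ∑ α ∈ idxEq N (⌈γ⌉₊ - 1),
      ⨆ (x : RN N) (h : {h : RN N // h ≠ 0}),
        ‖md α f (x + (h : RN N)) + md α f (x - (h : RN N)) - 2 • md α f x‖ / ‖(h : RN N)‖
  else
    ∑ α ∈ idxEq N (⌈γ⌉₊ - 1),
      ⨆ (x : RN N) (h : {h : RN N // h ≠ 0}),
        ‖md α f (x + (h : RN N)) - md α f x‖ / ‖(h : RN N)‖ ^ (γ - ((⌈γ⌉₊ - 1 : ℕ) : ℝ))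

/-- The (nonhomogeneous) Hölder–Zygmund norm `‖f‖_{Λ^γ} = ‖f‖_{L^∞} + [f]_γ`. -/
def hzNorm (γ : ℝ) (f : RN N → ℂ) : ℝ := (⨆ x, ‖f x‖) + hzSemi γ f

/-- The `bmo` norm: mean oscillation over small cubes plus means over large cubes. -/
def bmoNorm (g : RN N → ℂ) : ℝ≥0∞ :=
  (⨆ (c : RN N) (ℓ : {l : ℝ // 0 < l ∧ volume (cube c l) < 1}),
      ENNReal.ofReal (⨍ y in cube c ℓ.1, ‖g y - ⨍ z in cube c ℓ.1, g z‖)) +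
  (⨆ (c : RN N) (ℓ : {l : ℝ // 0 < l ∧ 1 ≤ volume (cube c l)}),
      ENNReal.ofReal (⨍ y in cube c ℓ.1, ‖g y‖))

section IteratedFDeriv

variable {E F : Type*} [NormedAddCommGroup E] [NormedSpace ℝ E]
  [NormedAddCommGroup F] [NormedSpace ℝ F]

lemma ContDiff.iteratedFDeriv_smooth {f : E → F} (hf : ContDiff ℝ (⊤ : ℕ∞) f) (n : ℕ) :
    ContDiff ℝ (⊤ : ℕ∞) (iteratedFDeriv ℝ n f) :=
  hf.iteratedFDeriv_right (m := (⊤ : ℕ∞)) (by exact_mod_cast le_top)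

lemma iteratedFDeriv_succ_succ_apply {f : E → F} (hf : ContDiff ℝ (⊤ : ℕ∞) f) (n : ℕ) (x : E)
    (v : Fin (n + 2) → E) :
    iteratedFDeriv ℝ (n + 2) f x v =
      fderiv ℝ (fderiv ℝ (iteratedFDeriv ℝ n f)) x (v 0) (v 1) (Fin.tail (Fin.tail v)) := by
  have hn : ContDiff ℝ (⊤ : ℕ∞) (iteratedFDeriv ℝ n f) := hf.iteratedFDeriv_smooth _
  have h1 : Differentiable ℝ (iteratedFDeriv ℝ (n + 1) f) :=
    (hf.iteratedFDeriv_smooth _).differentiable (by simp)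
  have h2 : Differentiable ℝ (fderiv ℝ (iteratedFDeriv ℝ n f)) :=
    (hn.fderiv_right (m := (⊤ : ℕ∞)) (by exact_mod_cast le_top)).differentiable (by simp)
  rw [(h1 x).iteratedFDeriv_succ_apply_left']
  have : (fun y => iteratedFDeriv ℝ (n + 1) f y (Fin.tail v)) =
      fun y => fderiv ℝ (iteratedFDeriv ℝ n f) y (v 1) (Fin.tail (Fin.tail v)) := by
    ext y
    rw [iteratedFDeriv_succ_apply_left]
    rfl
  rw [this]
  have h3 : DifferentiableAt ℝ (fun y => fderiv ℝ (iteratedFDeriv ℝ n f) y (v 1)) x := by fun_prop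
  rw [fderiv_continuousMultilinear_apply_const h3, fderiv_clm_apply (h2 x) (by fun_prop)]
  simp

lemma iteratedFDeriv_comp_swap {f : E → F} (hf : ContDiff ℝ (⊤ : ℕ∞) f) (n : ℕ) (i : Fin n) :
    ∀ (x : E) (v : Fin (n + 1) → E),
    iteratedFDeriv ℝ (n + 1) f x (v ∘ Equiv.swap i.castSucc i.succ) =
      iteratedFDeriv ℝ (n + 1) f x v := by
  induction n with
  | zero => exact i.elim0
  | succ n ih =>
    intro x v
    have hn : ContDiff ℝ (⊤ : ℕ∞) (iteratedFDeriv ℝ n f) :=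
      hf.iteratedFDeriv_smooth _
    have h1 : Differentiable ℝ (iteratedFDeriv ℝ (n + 1) f) :=
      (hf.iteratedFDeriv_smooth _).differentiable (by simp)
    refine Fin.cases ?_ (fun j => ?_) i
    · rw [iteratedFDeriv_succ_succ_apply hf, iteratedFDeriv_succ_succ_apply hf]
      have hs : IsSymmSndFDerivAt ℝ (iteratedFDeriv ℝ n f) x :=
        hn.contDiffAt.isSymmSndFDerivAt (by
          rw [minSmoothness_of_isRCLikeNormedField]
          exact WithTop.coe_le_coe.2 (le_top (a := (2 : ℕ∞))))
      have e0 : (v ∘ Equiv.swap (Fin.castSucc 0) (Fin.succ 0)) 0 = v 1 := by simp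
      have e1 : (v ∘ Equiv.swap (Fin.castSucc 0) (Fin.succ 0)) 1 = v 0 := by simp
      have e2 : Fin.tail (Fin.tail (v ∘ Equiv.swap (Fin.castSucc 0) (Fin.succ 0))) =
          Fin.tail (Fin.tail v) := by
        ext k
        simp only [Fin.tail, Function.comp]
        rw [Equiv.swap_apply_of_ne_of_ne]
        · simp [Fin.ext_iff]
        · simp [Fin.ext_iff]
      rw [e0, e1, e2, hs]
    · rw [(h1 x).iteratedFDeriv_succ_apply_left', (h1 x).iteratedFDeriv_succ_apply_left']
      have e0 : (v ∘ Equiv.swap (Fin.castSucc j.succ) (Fin.succ j.succ)) 0 = v 0 := by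
        simp only [Function.comp]
        rw [Equiv.swap_apply_of_ne_of_ne] <;> simp [Fin.ext_iff]
      have e1 : Fin.tail (v ∘ Equiv.swap (Fin.castSucc j.succ) (Fin.succ j.succ)) =
          Fin.tail v ∘ Equiv.swap j.castSucc j.succ := by
        ext k
        simp only [Fin.tail, Function.comp]
        congr 1
        have := (Fin.succ_injective (n + 1)).map_swap j.castSucc j.succ k
        rw [this]; rfl
      rw [e0, e1]
      congr 2
      ext y
      exact ih j y _

/-- Iterated derivatives of smooth functions are symmetric. -/
lemma iteratedFDeriv_comp_perm_of_smooth {f : E → F} (hf : ContDiff ℝ (⊤ : ℕ∞) f) (n : ℕ)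
    (σ : Equiv.Perm (Fin n)) (x : E) (v : Fin n → E) :
    iteratedFDeriv ℝ n f x (v ∘ σ) = iteratedFDeriv ℝ n f x v := by
  cases n with
  | zero => congr 1; exact Subsingleton.elim _ _
  | succ n =>
    have hσ : σ ∈ Submonoid.closure
        (Set.range fun i : Fin n => Equiv.swap i.castSucc i.succ) := by
      rw [Equiv.Perm.mclosure_swap_castSucc_succ]; trivial
    induction hσ using Submonoid.closure_induction generalizing v with
    | mem τ hτ =>
      obtain ⟨i, rfl⟩ := hτ
      exact iteratedFDeriv_comp_swap hf n i x v
    | one => rfl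
    | mul σ τ _ _ h1 h2 =>
      rw [Equiv.Perm.coe_mul, ← Function.comp_assoc, h2, h1]

/-- Smooth functions whose derivatives of order at least `m` all vanish, i.e. polynomials of
degree less than `m`. -/
def PolyLT (m : ℕ) (P : E → F) : Prop :=
  ContDiff ℝ (⊤ : ℕ∞) P ∧ ∀ k, m ≤ k → ∀ x, iteratedFDeriv ℝ k P x = 0

/-- Existence of Taylor polynomials. -/
lemma exists_taylor [CompleteSpace F] {f : E → F} (hf : ContDiff ℝ (⊤ : ℕ∞) f) (m : ℕ) (a : E) :
    ∃ T : E → F, PolyLT m T ∧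
      ∀ j < m, iteratedFDeriv ℝ j T a = iteratedFDeriv ℝ j f a := by
  let p : FormalMultilinearSeries ℝ E F := fun j =>
    if j < m then ((j.factorial : ℝ)⁻¹) • iteratedFDeriv ℝ j f a else 0
  let T : E → F := fun y => ∑ j ∈ Finset.range m, p j fun _ => y - a
  have hT : HasFiniteFPowerSeriesOnBall T p a m ⊤ := by
    refine HasFiniteFPowerSeriesOnBall.mk' (fun j hj => ?_) (by simp) (fun y _ => ?_)
    · simp [p, hj]
    · simp [T]
  have hT' (y : E) : HasFiniteFPowerSeriesOnBall T (p.changeOrigin (y - a)) y m ⊤ := by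
    have := hT.changeOrigin (y := y - a) (by simp)
    simpa using this
  have hsm : ContDiff ℝ (⊤ : ℕ∞) T :=
    contDiff_iff_contDiffAt.2 fun y => (hT' y).cpolynomialAt.contDiffAt
  refine ⟨T, ⟨hsm, fun k hk y => ?_⟩, fun j hj => ?_⟩
  · ext v
    rw [(hT' y).toHasFPowerSeriesOnBall.iteratedFDeriv_eq_sum_of_completeSpace]
    rw [(hT' y).finite k hk]
    simp
  · ext v
    rw [hT.toHasFPowerSeriesOnBall.iteratedFDeriv_eq_sum_of_completeSpace]
    have : ∀ σ : Equiv.Perm (Fin j), p j (fun i => v (σ i)) =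
        ((j.factorial : ℝ)⁻¹) • iteratedFDeriv ℝ j f a v := by
      intro σ
      have := iteratedFDeriv_comp_perm_of_smooth hf j σ a v
      simp only [p, hj, if_true, smul_apply]
      rw [← this]
      rfl
    simp_rw [this]
    simp only [Finset.sum_const, Finset.card_univ, Fintype.card_perm, Fintype.card_fin]
    rw [← Nat.cast_smul_eq_nsmul ℝ, smul_smul, mul_inv_cancel₀ (by positivity), one_smul]

/-- Bounds on the lower order derivatives of a function vanishing to order `m` at a point. -/
lemma norm_iteratedFDeriv_le_of_vanish {f : E → F} (hf : ContDiff ℝ (⊤ : ℕ∞) f) {m : ℕ} {a : E}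
    {ρ B : ℝ} (hρ : 0 ≤ ρ) (h0 : ∀ j < m, iteratedFDeriv ℝ j f a = 0)
    (hB : ∀ y ∈ closedBall a ρ, ‖iteratedFDeriv ℝ m f y‖ ≤ B) (i : ℕ) (hi : i ≤ m) :
    ∀ y ∈ closedBall a ρ, ‖iteratedFDeriv ℝ (m - i) f y‖ ≤ B * ρ ^ i := by
  induction i with
  | zero => simpa using hB
  | succ i ih =>
    intro y hy
    have hB0 : 0 ≤ B := (norm_nonneg _).trans (hB a (mem_closedBall_self hρ))
    have ih := ih (by omega)
    have hd : Differentiable ℝ (iteratedFDeriv ℝ (m - (i + 1)) f) :=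
      (hf.iteratedFDeriv_smooth _).differentiable (by simp)
    have hc := (convex_closedBall a ρ).norm_image_sub_le_of_norm_fderiv_le
      (f := iteratedFDeriv ℝ (m - (i + 1)) f) (C := B * ρ ^ i) (𝕜 := ℝ)
      (fun z _ => hd z) (fun z hz => by
        rw [norm_fderiv_iteratedFDeriv]
        have : m - (i + 1) + 1 = m - i := by omega
        rw [this]
        exact ih z hz) (mem_closedBall_self hρ) hy
    rw [h0 _ (by omega), sub_zero] at hc
    refine hc.trans ?_
    rw [pow_succ, ← mul_assoc]
    exact mul_le_mul_of_nonneg_left (by simpa [dist_eq_norm] using hy) (by positivity)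

end IteratedFDeriv

section Polynomials

lemma PolyLT.of_iteratedFDeriv_eq_zero {m : ℕ} {P : RN N → ℝ} (hP : ContDiff ℝ (⊤ : ℕ∞) P)
    (h : ∀ x, iteratedFDeriv ℝ m P x = 0) : PolyLT m P := by
  refine ⟨hP, fun k hk => ?_⟩
  induction k, hk using Nat.le_induction with
  | base => exact h
  | succ k _ ih =>
    intro x
    have : iteratedFDeriv ℝ k P = fun _ => 0 := funext ih
    ext v
    rw [iteratedFDeriv_succ_apply_left, this]
    simp

lemma PolyLT.mono {m m' : ℕ} {P : RN N → ℝ} (hP : PolyLT m P) (h : m ≤ m') : PolyLT m' P :=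
  ⟨hP.1, fun k hk => hP.2 k (h.trans hk)⟩

lemma PolyLT.mul {a b : ℕ} {P Q : RN N → ℝ} (hP : PolyLT (a + 1) P) (hQ : PolyLT (b + 1) Q) :
    PolyLT (a + b + 1) (fun y => P y * Q y) := by
  refine ⟨hP.1.mul hQ.1, fun k hk x => ?_⟩
  rw [← norm_le_zero_iff]
  refine (norm_iteratedFDeriv_mul_le hP.1 hQ.1 x (n := k) (by exact_mod_cast le_top)).trans ?_
  refine Finset.sum_nonpos fun i hi => ?_
  by_cases h : a + 1 ≤ i
  · simp [hP.2 i h]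
  · simp [hQ.2 (k - i) (by omega)]

lemma PolyLT.const (c : ℝ) : PolyLT 1 (fun _ : RN N => c) :=
  ⟨contDiff_const, fun k hk x => by rw [iteratedFDeriv_const_of_ne (by omega)]; rfl⟩

lemma PolyLT.coord (i : Fin N) : PolyLT 2 (fun x : RN N => x i) := by
  refine PolyLT.of_iteratedFDeriv_eq_zero (by fun_prop) fun x => ?_
  rw [← norm_eq_zero, ← norm_iteratedFDeriv_fderiv]
  have : fderiv ℝ (fun x : RN N => x i) = fun _ => (EuclideanSpace.proj i : RN N →L[ℝ] ℝ) := by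
    ext1 y
    exact (EuclideanSpace.proj i : RN N →L[ℝ] ℝ).hasFDerivAt.fderiv
  rw [this, iteratedFDeriv_const_of_ne one_ne_zero]
  simp

lemma PolyLT.coord_pow (i : Fin N) (n : ℕ) : PolyLT (n + 1) (fun x : RN N => x i ^ n) := by
  induction n with
  | zero => simpa using PolyLT.const 1
  | succ n ih => simpa [pow_succ] using ih.mul (PolyLT.coord i)

lemma PolyLT.monomial (γ : Fin N → ℕ) :
    PolyLT (mOrder γ + 1) (fun x : RN N => ∏ i, x i ^ γ i) := by
  unfold mOrder
  generalize (Finset.univ : Finset (Fin N)) = s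
  induction s using Finset.induction_on with
  | empty => simpa using PolyLT.const 1
  | insert i s hi ih =>
    simp only [Finset.prod_insert hi, Finset.sum_insert hi]
    exact (PolyLT.coord_pow i (γ i)).mul ih

lemma iteratedFDeriv_comp_smul_sub {P : RN N → ℝ} (hP : ContDiff ℝ (⊤ : ℕ∞) P) (k : ℕ) (c : ℝ)
    (a y : RN N) : iteratedFDeriv ℝ k (fun y => P (c • (y - a))) y =
      c ^ k • iteratedFDeriv ℝ k P (c • (y - a)) := by
  rw [iteratedFDeriv_comp_sub (f := fun y => P (c • y)),
    iteratedFDeriv_comp_const_smul c (hP.of_le (by exact_mod_cast le_top))]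

lemma PolyLT.comp_affine {m : ℕ} {P : RN N → ℝ} (hP : PolyLT m P) (c : ℝ) (a : RN N) :
    PolyLT m (fun y => P (c • (y - a))) := by
  have := hP.1
  refine ⟨by fun_prop, fun k hk x => ?_⟩
  rw [iteratedFDeriv_comp_smul_sub hP.1, hP.2 k hk, smul_zero]

lemma PolyLT.eq_zero {m : ℕ} {P : RN N → ℝ} (hP : PolyLT m P) {a : RN N}
    (h : ∀ j < m, iteratedFDeriv ℝ j P a = 0) : P = 0 := by
  ext y
  have := norm_iteratedFDeriv_le_of_vanish (B := 0) hP.1 (dist_nonneg (x := y) (y := a)) h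
    (fun z _ => by simp [hP.2 m le_rfl z]) m le_rfl y (by simp)
  rw [Nat.sub_self, norm_iteratedFDeriv_zero] at this
  simpa using this

/-- The space of real polynomials of degree less than `m` on `ℝ^N`. -/
def polySubmodule (N m : ℕ) : Submodule ℝ (RN N → ℝ) where
  carrier := {P | PolyLT m P}
  add_mem' {P Q} hP hQ := by
    refine ⟨hP.1.add hQ.1, fun k hk x => ?_⟩
    rw [iteratedFDeriv_add_apply, hP.2 k hk, hQ.2 k hk, add_zero]
    · exact (hP.1.of_le (by exact_mod_cast le_top)).contDiffAt
    · exact (hQ.1.of_le (by exact_mod_cast le_top)).contDiffAt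
  zero_mem' := ⟨contDiff_const, fun k _ x => by
    change iteratedFDeriv ℝ k (fun _ => 0) x = 0
    rw [iteratedFDeriv_fun_zero]; rfl⟩
  smul_mem' c P hP := by
    refine ⟨contDiff_const.smul hP.1, fun k hk x => ?_⟩
    rw [iteratedFDeriv_const_smul_apply, hP.2 k hk, smul_zero]
    exact (hP.1.of_le (by exact_mod_cast le_top)).contDiffAt

instance (n : ℕ) : FiniteDimensional ℝ (RN N [×n]→L[ℝ] ℝ) :=
  FiniteDimensional.of_injective (ContinuousMultilinearMap.toMultilinearMapLinear :
    (RN N [×n]→L[ℝ] ℝ) →ₗ[ℝ] _) ContinuousMultilinearMap.toMultilinearMap_injective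

instance (m : ℕ) : FiniteDimensional ℝ (polySubmodule N m) := by
  let J : polySubmodule N m →ₗ[ℝ] ((j : Fin m) → RN N [×j]→L[ℝ] ℝ) :=
    { toFun := fun P j => iteratedFDeriv ℝ j P.1 0
      map_add' := fun P Q => by
        ext1 j
        exact iteratedFDeriv_add_apply (P.2.1.of_le (by exact_mod_cast le_top)).contDiffAt
          (Q.2.1.of_le (by exact_mod_cast le_top)).contDiffAt
      map_smul' := fun c P => by
        ext1 j
        exact iteratedFDeriv_const_smul_apply (P.2.1.of_le (by exact_mod_cast le_top)).contDiffAt }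
  refine FiniteDimensional.of_injective J ((injective_iff_map_eq_zero J).2 fun P hP => ?_)
  ext1
  exact P.2.eq_zero (a := 0) fun j hj => congrFun hP ⟨j, hj⟩

/-- A finite system of polynomials spanning the polynomials of degree less than `m`, together with
smooth functions supported in the unit ball computing the coefficients. -/
lemma exists_dual_system (N m : ℕ) : ∃ (n : ℕ) (b e : Fin n → RN N → ℝ),
    (∀ i, PolyLT m (b i)) ∧ (∀ i, ContDiff ℝ (⊤ : ℕ∞) (e i)) ∧
    (∀ i, tsupport (e i) ⊆ closedBall 0 1) ∧
    ∀ Q : RN N → ℝ, PolyLT m Q → ∀ y, Q y = ∑ i, (∫ z, e i z * Q z) * b i y := by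
  let ω : ContDiffBump (0 : RN N) := ⟨1 / 2, 1, by norm_num, by norm_num⟩
  have hω : ContDiff ℝ (⊤ : ℕ∞) ω := ω.contDiff
  have hint : ∀ P Q : RN N → ℝ, PolyLT m P → PolyLT m Q →
      Integrable fun z => ω z * P z * Q z := fun P Q hP hQ =>
    ((hω.continuous.mul hP.1.continuous).mul hQ.1.continuous).integrable_of_hasCompactSupport
      (ω.hasCompactSupport.mul_right.mul_right)
  let B : LinearMap.BilinForm ℝ (polySubmodule N m) := LinearMap.mk₂ ℝ
    (fun P Q => ∫ z, ω z * P.1 z * Q.1 z)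
    (fun P P' Q => by
      rw [← integral_add (hint _ _ P.2 Q.2) (hint _ _ P'.2 Q.2)]
      congr 1; ext z; simp; ring)
    (fun c P Q => by
      rw [smul_eq_mul, ← integral_const_mul]
      congr 1; ext z; simp; ring)
    (fun P Q Q' => by
      rw [← integral_add (hint _ _ P.2 Q.2) (hint _ _ P.2 Q'.2)]
      congr 1; ext z; simp; ring)
    (fun c P Q => by
      rw [smul_eq_mul, ← integral_const_mul]
      congr 1; ext z; simp; ring)
  have hpos : ∀ P : polySubmodule N m, B P P = 0 → P = 0 := by
    intro P hP
    have hP' : ∫ z, ω z * P.1 z * P.1 z = 0 := hP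
    have hc : Continuous fun z => ω z * P.1 z * P.1 z :=
      (hω.continuous.mul P.2.1.continuous).mul P.2.1.continuous
    have h0 : (fun z => ω z * P.1 z * P.1 z) = 0 := by
      refine (hc.ae_eq_iff_eq volume continuous_const).1 ?_
      refine (integral_eq_zero_iff_of_nonneg (fun z => ?_) (hint _ _ P.2 P.2)).1 hP'
      simp only [Pi.zero_apply, mul_assoc]
      exact mul_nonneg ω.nonneg (mul_self_nonneg _)
    have h1 : P.1 =ᶠ[𝓝 0] 0 := by
      filter_upwards [ball_mem_nhds (0 : RN N) (one_half_pos (α := ℝ))] with z hz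
      have hz1 : ω z = 1 := ω.one_of_mem_closedBall (ball_subset_closedBall hz)
      have := congrFun h0 z
      simpa [hz1] using this
    ext1
    refine P.2.eq_zero (a := 0) fun j _ => ?_
    rw [(h1.iteratedFDeriv ℝ j).eq_of_nhds]
    change iteratedFDeriv ℝ j (fun _ => 0) 0 = 0
    rw [iteratedFDeriv_fun_zero]; rfl
  have hB : B.Nondegenerate :=
    ⟨fun P hP => hpos P (hP P), fun P hP => hpos P (hP P)⟩
  let v := Module.finBasis ℝ (polySubmodule N m)
  let w := B.dualBasis hB v
  refine ⟨_, fun i => (v i).1, fun i z => ω z * (w i).1 z, fun i => (v i).2,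
    fun i => hω.mul (w i).2.1, fun i => ?_, fun Q hQ y => ?_⟩
  · refine (tsupport_mul_subset_left).trans ?_
    rw [ω.tsupport_eq]
  · have hQ' := v.sum_repr ⟨Q, hQ⟩
    have hco : ∀ i, ∫ z, ω z * (w i).1 z * Q z = v.repr ⟨Q, hQ⟩ i := by
      intro i
      change B (w i) ⟨Q, hQ⟩ = _
      have hl : ∀ j, B (w i) (v j) = if j = i then 1 else 0 := fun j =>
        LinearMap.BilinForm.apply_dualBasis_left hB v i j
      calc B (w i) ⟨Q, hQ⟩ = B (w i) (∑ j, v.repr ⟨Q, hQ⟩ j • v j) := by rw [hQ']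
        _ = _ := by simp [-Module.Basis.sum_repr, map_sum, hl]
    simp only [hco]
    calc Q y = (∑ i, v.repr ⟨Q, hQ⟩ i • v i : polySubmodule N m).1 y := by rw [hQ']
      _ = _ := by simp [-Module.Basis.sum_repr]

end Polynomials

section TestFunctions

lemma norm_iteratedFDeriv_pd_le {u : RN N → ℝ} (hu : ContDiff ℝ (⊤ : ℕ∞) u) (i : Fin N) (j : ℕ)
    (z : RN N) : ‖iteratedFDeriv ℝ j (pd i u) z‖ ≤ ‖iteratedFDeriv ℝ (j + 1) u z‖ := by
  have h1 : ContDiff ℝ (⊤ : ℕ∞) (fderiv ℝ u) :=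
    hu.fderiv_right (m := (⊤ : ℕ∞)) (by exact_mod_cast le_top)
  have := norm_iteratedFDeriv_clm_apply_const (𝕜 := ℝ) (f := fderiv ℝ u) (x := z)
    (c := EuclideanSpace.single i (1 : ℝ)) (n := j) (N := ((⊤ : ℕ∞) : WithTop ℕ∞)) h1.contDiffAt
    (by exact_mod_cast le_top)
  rw [norm_iteratedFDeriv_fderiv] at this
  have he : pd i u = fun y => fderiv ℝ u y (EuclideanSpace.single i 1) := rfl
  rw [he]
  simpa using this

lemma ContDiff.pd {u : RN N → ℝ} (hu : ContDiff ℝ (⊤ : ℕ∞) u) (i : Fin N) :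
    ContDiff ℝ (⊤ : ℕ∞) (pd i u) :=
  (hu.fderiv_right (m := (⊤ : ℕ∞)) (by exact_mod_cast le_top)).clm_apply contDiff_const

lemma iterate_pd_bound {u : RN N → ℝ} (hu : ContDiff ℝ (⊤ : ℕ∞) u) (i : Fin N) (k : ℕ) :
    ContDiff ℝ (⊤ : ℕ∞) ((pd i)^[k] u) ∧
      ∀ j z, ‖iteratedFDeriv ℝ j ((pd i)^[k] u) z‖ ≤ ‖iteratedFDeriv ℝ (j + k) u z‖ := by
  induction k with
  | zero => exact ⟨hu, fun j z => le_rfl⟩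
  | succ k ih =>
    rw [Function.iterate_succ_apply']
    refine ⟨ih.1.pd i, fun j z => (norm_iteratedFDeriv_pd_le ih.1 i j z).trans ?_⟩
    rw [← add_assoc, add_right_comm]
    exact ih.2 (j + 1) z

lemma foldr_pd_bound {u : RN N → ℝ} (hu : ContDiff ℝ (⊤ : ℕ∞) u) {n : ℕ} (g : Fin n → Fin N)
    (α : Fin n → ℕ) :
    ContDiff ℝ (⊤ : ℕ∞) (((List.ofFn fun i => (pd (E := ℝ) (g i))^[α i]).foldr (· ∘ ·) id) u) ∧
      ∀ j z, ‖iteratedFDeriv ℝ j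
        (((List.ofFn fun i => (pd (E := ℝ) (g i))^[α i]).foldr (· ∘ ·) id) u) z‖ ≤
          ‖iteratedFDeriv ℝ (j + ∑ i, α i) u z‖ := by
  induction n with
  | zero => exact ⟨hu, fun j z => le_rfl⟩
  | succ n ih =>
    have h := ih (fun i => g i.succ) (fun i => α i.succ)
    simp only [List.ofFn_succ, List.foldr_cons, Function.comp_apply]
    have h2 := iterate_pd_bound h.1 (g 0) (α 0)
    refine ⟨h2.1, fun j z => (h2.2 j z).trans ?_⟩
    rw [Fin.sum_univ_succ, ← add_assoc]
    exact h.2 _ z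

/-- Partial derivatives are bounded by the norm of the full derivative of the same order. -/
lemma abs_md_le {u : RN N → ℝ} (hu : ContDiff ℝ (⊤ : ℕ∞) u) (α : Fin N → ℕ) (z : RN N) :
    |md α u z| ≤ ‖iteratedFDeriv ℝ (mOrder α) u z‖ := by
  have := (foldr_pd_bound hu id α).2 0 z
  rw [zero_add, norm_iteratedFDeriv_zero] at this
  exact this

lemma md_const_mul {u : RN N → ℝ} (hu : ContDiff ℝ (⊤ : ℕ∞) u) (α : Fin N → ℕ) (c : ℝ)
    (z : RN N) : |md α (fun y => c * u y) z| ≤ |c| * ‖iteratedFDeriv ℝ (mOrder α) u z‖ := by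
  refine (abs_md_le (contDiff_const.mul hu) α z).trans ?_
  have : (fun y => c * u y) = c • u := rfl
  rw [this, iteratedFDeriv_const_smul_apply (hu.of_le (by exact_mod_cast le_top)).contDiffAt,
    norm_smul, Real.norm_eq_abs]

/-- Functions with scaled derivative bounds are admissible in the grand maximal function. -/
lemma le_grandMax {L : ℕ} {f : RN N → ℂ} {x : RN N} {u : RN N → ℝ}
    (hu : ContDiff ℝ (⊤ : ℕ∞) u) {A K r : ℝ} (hA : 0 < A) (hK : 1 ≤ K) (hr : 0 < r)
    (hs : tsupport u ⊆ ball x (K * r))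
    (hb : ∀ j ≤ L, ∀ z, ‖iteratedFDeriv ℝ j u z‖ ≤ A / r ^ (N + j)) :
    ENNReal.ofReal ‖∫ z, u z • f z‖ ≤ ENNReal.ofReal (A * K ^ (N + L)) * grandMax L f x := by
  have hK0 : 0 < K := by linarith
  set B := A * K ^ (N + L) with hB
  have hB0 : 0 < B := by positivity
  have hmem : (fun y => B⁻¹ * u y) ∈ calF L x (K * r) := by
    have hts : tsupport (fun y => B⁻¹ * u y) ⊆ tsupport u :=
      closure_mono fun y hy h0 => hy (by simp [h0])
    have hcs : HasCompactSupport u :=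
      HasCompactSupport.of_support_subset_isCompact (isCompact_closedBall x (K * r))
        ((subset_tsupport _).trans (hs.trans ball_subset_closedBall))
    refine ⟨contDiff_const.mul hu, hcs.mono' ((subset_tsupport _).trans hts),
      hts.trans hs, fun α hα z => (md_const_mul hu α _ z).trans ?_⟩
    rw [abs_of_pos (inv_pos.2 hB0)]
    refine (mul_le_mul_of_nonneg_left (hb _ hα z) (inv_pos.2 hB0).le).trans ?_
    rw [mul_pow, mul_inv (K ^ _), hB, mul_inv A]
    have : K ^ (N + mOrder α) ≤ K ^ (N + L) := pow_le_pow_right₀ hK (by omega)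
    calc A⁻¹ * (K ^ (N + L))⁻¹ * (A / r ^ (N + mOrder α))
        = (K ^ (N + L))⁻¹ * (r ^ (N + mOrder α))⁻¹ := by field_simp
      _ ≤ _ := by gcongr
  have hle : ENNReal.ofReal ‖∫ z, (B⁻¹ * u z) • f z‖ ≤ grandMax L f x :=
    le_iSup₂_of_le (K * r) (by positivity) (le_iSup₂_of_le _ hmem le_rfl)
  have heq : ∫ z, u z • f z = B • ∫ z, (B⁻¹ * u z) • f z := by
    rw [← integral_smul]
    congr 1; ext1 z
    rw [smul_smul, ← mul_assoc, mul_inv_cancel₀ hB0.ne', one_mul]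
  rw [heq, norm_smul, Real.norm_of_nonneg hB0.le, ENNReal.ofReal_mul hB0.le]
  gcongr

/-- Bounds on the first `J` derivatives of `u` at `y`, at scale `r⁻¹`. -/
def ScaledBound (J : ℕ) (A r : ℝ) (u : RN N → ℝ) (y : RN N) : Prop :=
  ∀ j ≤ J, ‖iteratedFDeriv ℝ j u y‖ ≤ A * r ^ j

lemma ScaledBound.mono {J : ℕ} {A B r r' : ℝ} {u : RN N → ℝ} {y : RN N}
    (h : ScaledBound J A r u y) (hA : 0 ≤ A) (hAB : A ≤ B) (hr : 0 ≤ r) (hrr' : r ≤ r') :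
    ScaledBound J B r' u y :=
  fun j hj => (h j hj).trans (by gcongr; exact hA.trans hAB)

lemma ScaledBound.mul {J : ℕ} {A B r : ℝ} {u v : RN N → ℝ} {y : RN N}
    (hu : ScaledBound J A r u y) (hv : ScaledBound J B r v y)
    (hus : ContDiff ℝ (⊤ : ℕ∞) u) (hvs : ContDiff ℝ (⊤ : ℕ∞) v)
    (hA : 0 ≤ A) (hB : 0 ≤ B) (hr : 0 ≤ r) :
    ScaledBound J (2 ^ J * A * B) r (fun y => u y * v y) y := by
  intro j hj
  refine (norm_iteratedFDeriv_mul_le hus hvs y (n := j) (by exact_mod_cast le_top)).trans ?_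
  calc ∑ i ∈ Finset.range (j + 1),
        (j.choose i : ℝ) * ‖iteratedFDeriv ℝ i u y‖ * ‖iteratedFDeriv ℝ (j - i) v y‖
      ≤ ∑ i ∈ Finset.range (j + 1), (j.choose i : ℝ) * (A * B * r ^ j) := by
        refine Finset.sum_le_sum fun i hi => ?_
        have hi' : i ≤ j := by simpa [Nat.lt_succ_iff] using hi
        rw [mul_assoc]
        refine mul_le_mul_of_nonneg_left ?_ (by positivity)
        calc _ ≤ (A * r ^ i) * (B * r ^ (j - i)) :=
              mul_le_mul (hu i (hi'.trans hj)) (hv _ ((Nat.sub_le _ _).trans hj)) (norm_nonneg _)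
                (by positivity)
          _ = A * B * (r ^ i * r ^ (j - i)) := by ring
          _ = _ := by rw [← pow_add, Nat.add_sub_cancel' hi']
    _ = 2 ^ j * (A * B * r ^ j) := by
        rw [← Finset.sum_mul]
        congr 1
        exact_mod_cast Nat.sum_range_choose j
    _ ≤ 2 ^ J * (A * B * r ^ j) := by
        gcongr
        norm_num
    _ = _ := by ring

lemma ScaledBound.sub {J : ℕ} {A B r : ℝ} {u v : RN N → ℝ} {y : RN N}
    (hu : ScaledBound J A r u y) (hv : ScaledBound J B r v y)
    (hus : ContDiff ℝ (⊤ : ℕ∞) u) (hvs : ContDiff ℝ (⊤ : ℕ∞) v) :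
    ScaledBound J (A + B) r (fun y => u y - v y) y := by
  intro j hj
  have : (fun y => u y - v y) = u - v := rfl
  rw [this, iteratedFDeriv_sub_apply (hus.of_le (by exact_mod_cast le_top)).contDiffAt
    (hvs.of_le (by exact_mod_cast le_top)).contDiffAt, add_mul]
  exact (norm_sub_le _ _).trans (add_le_add (hu j hj) (hv j hj))

lemma ScaledBound.const_mul {J : ℕ} {A r c B : ℝ} {u : RN N → ℝ} {y : RN N}
    (hu : ScaledBound J A r u y) (hus : ContDiff ℝ (⊤ : ℕ∞) u) (hc : |c| ≤ B) :
    ScaledBound J (B * A) r (fun y => c * u y) y := by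
  intro j hj
  have : (fun y => c * u y) = c • u := rfl
  rw [this, iteratedFDeriv_const_smul_apply (hus.of_le (by exact_mod_cast le_top)).contDiffAt,
    norm_smul, Real.norm_eq_abs, mul_assoc]
  exact mul_le_mul hc (hu j hj) (norm_nonneg _) ((abs_nonneg _).trans hc)

lemma ScaledBound.sum {J n : ℕ} {A r : ℝ} {u : Fin n → RN N → ℝ} {y : RN N}
    (hu : ∀ i, ScaledBound J A r (u i) y) (hus : ∀ i, ContDiff ℝ (⊤ : ℕ∞) (u i)) :
    ScaledBound J (n * A) r (fun y => ∑ i, u i y) y := by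
  intro j hj
  rw [iteratedFDeriv_fun_sum_apply
    fun i _ => ((hus i).of_le (by exact_mod_cast le_top)).contDiffAt]
  refine (norm_sum_le _ _).trans ((Finset.sum_le_sum fun i _ => hu i j hj).trans ?_)
  simp [mul_assoc]

lemma ScaledBound.comp_smul_sub {J : ℕ} {A c : ℝ} {u : RN N → ℝ} {a y : RN N}
    (hus : ContDiff ℝ (⊤ : ℕ∞) u) (hu : ScaledBound J A 1 u (c • (y - a))) :
    ScaledBound J A |c| (fun y => u (c • (y - a))) y := by
  intro j hj
  rw [iteratedFDeriv_comp_smul_sub hus, norm_smul, norm_pow, Real.norm_eq_abs, mul_comm]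
  gcongr
  simpa using hu j hj

lemma scaledBound_of_eventuallyEq {J : ℕ} {A r : ℝ} {u v : RN N → ℝ} {y : RN N}
    (h : u =ᶠ[𝓝 y] v) (hv : ScaledBound J A r v y) : ScaledBound J A r u y := by
  intro j hj
  rw [(h.iteratedFDeriv ℝ j).eq_of_nhds]
  exact hv j hj

lemma scaledBound_of_notMem_tsupport {J : ℕ} {A r : ℝ} {u : RN N → ℝ} {y : RN N}
    (hy : y ∉ tsupport u) (hA : 0 ≤ A) (hr : 0 ≤ r) : ScaledBound J A r u y := by
  intro j hj
  have : iteratedFDeriv ℝ j u y = 0 := by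
    by_contra h
    exact hy (support_iteratedFDeriv_subset (𝕜 := ℝ) j h)
  rw [this, norm_zero]
  positivity

lemma exists_scaledBound_of_isCompact {u : RN N → ℝ} (hu : ContDiff ℝ (⊤ : ℕ∞) u) (J : ℕ)
    {K : Set (RN N)} (hK : IsCompact K) :
    ∃ C, 0 < C ∧ ∀ y ∈ K, ScaledBound J C 1 u y := by
  have : ∀ j : ℕ, ∃ C, ∀ y ∈ K, ‖iteratedFDeriv ℝ j u y‖ ≤ C := fun j =>
    hK.exists_bound_of_continuousOn (hu.iteratedFDeriv_smooth j).continuous.continuousOn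
  choose C hC using this
  refine ⟨1 + ∑ j ∈ Finset.range (J + 1), |C j|, by positivity, fun y hy j hj => ?_⟩
  rw [one_pow, mul_one]
  have := Finset.single_le_sum (f := fun j => |C j|) (fun i _ => abs_nonneg _)
    (Finset.mem_range.2 (Nat.lt_succ_of_le hj))
  linarith [hC j y hy, le_abs_self (C j)]

lemma exists_scaledBound_of_hasCompactSupport {u : RN N → ℝ} (hu : ContDiff ℝ (⊤ : ℕ∞) u)
    (hs : HasCompactSupport u) (J : ℕ) : ∃ C, 0 < C ∧ ∀ y, ScaledBound J C 1 u y := by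
  obtain ⟨C, hC, h⟩ := exists_scaledBound_of_isCompact hu J hs
  refine ⟨C, hC, fun y => ?_⟩
  by_cases hy : y ∈ tsupport u
  · exact h y hy
  · exact scaledBound_of_notMem_tsupport hy hC.le zero_le_one

/-- Derivative bounds for the dilates of `φ`. -/
lemma exists_dil_bound {φ : RN N → ℝ} (hφ : GoodPhi φ) (J : ℕ) :
    ∃ C, 0 < C ∧ ∀ t > 0, ∀ x : RN N, ContDiff ℝ (⊤ : ℕ∞) (fun y => dil φ t (x - y)) ∧
      tsupport (fun y => dil φ t (x - y)) ⊆ closedBall x t ∧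
      ∀ y, ScaledBound J (C / t ^ N) t⁻¹ (fun y => dil φ t (x - y)) y := by
  have hsm := hφ.smooth
  have hcs : HasCompactSupport φ :=
    HasCompactSupport.of_support_subset_isCompact (isCompact_closedBall 0 1)
      ((subset_tsupport _).trans hφ.supp)
  obtain ⟨C, hC, h⟩ := exists_scaledBound_of_hasCompactSupport hsm hcs J
  refine ⟨C, hC, fun t ht x => ?_⟩
  have heq : (fun y => dil φ t (x - y)) = fun y => (t ^ N)⁻¹ * φ ((-t⁻¹) • (y - x)) := by
    ext y
    rw [dil, neg_smul, ← smul_neg, neg_sub, div_eq_inv_mul]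
  have hsm' : ContDiff ℝ (⊤ : ℕ∞) (fun y => φ ((-t⁻¹) • (y - x))) := by fun_prop
  refine ⟨heq ▸ contDiff_const.mul hsm', ?_, fun y => ?_⟩
  · refine closure_minimal (fun y hy => ?_) isClosed_closedBall
    have : φ (t⁻¹ • (x - y)) ≠ 0 := fun h0 => hy (by simp [dil, h0])
    have := hφ.supp (subset_tsupport _ this)
    rw [mem_closedBall_zero_iff, norm_smul, norm_inv, Real.norm_of_nonneg ht.le,
      inv_mul_le_iff₀ ht, mul_one] at this
    rwa [mem_closedBall, dist_comm, dist_eq_norm]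
  · rw [heq]
    have h1 := ScaledBound.comp_smul_sub (c := -t⁻¹) (a := x) (y := y) hsm (h _)
    rw [abs_neg, abs_of_pos (inv_pos.2 ht)] at h1
    have h2 := h1.const_mul hsm' (c := (t ^ N)⁻¹) (B := (t ^ N)⁻¹) (abs_of_pos (by positivity)).le
    rwa [← div_eq_inv_mul] at h2

end TestFunctions

section DualSystem

lemma norm_integral_le_of_tsupport {E : Type*} [NormedAddCommGroup E] [NormedSpace ℝ E]
    {u : RN N → E} {a : RN N} {s D : ℝ} (hs : 0 < s) (hu : Function.support u ⊆ closedBall a s)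
    (hD : ∀ y ∈ closedBall a s, ‖u y‖ ≤ D) :
    ‖∫ y, u y‖ ≤ D * (s ^ N * (volume : Measure (RN N)).real (ball 0 1)) := by
  have hfin : volume (closedBall a s) < ⊤ := measure_closedBall_lt_top
  rw [← setIntegral_eq_integral_of_forall_compl_eq_zero (s := closedBall a s)
    (fun x hx => by_contra fun h => hx (hu h))]
  refine (norm_setIntegral_le_of_norm_le_const hfin hD).trans_eq ?_
  rw [Measure.addHaar_real_closedBall _ _ hs.le]
  simp

/-- `b`, `e` reproduce polynomials of degree less than `m` on the ball of centre `a` and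
radius `s`, with controlled size. -/
structure DualSystem (m L : ℕ) (C R : ℝ) (a : RN N) (s : ℝ) {n : ℕ} (b e : Fin n → RN N → ℝ) :
    Prop where
  smooth_b : ∀ i, ContDiff ℝ (⊤ : ℕ∞) (b i)
  smooth_e : ∀ i, ContDiff ℝ (⊤ : ℕ∞) (e i)
  tsupport_e : ∀ i, tsupport (e i) ⊆ closedBall a s
  abs_e_le : ∀ i y, |e i y| ≤ C / s ^ N
  bound_b : ∀ i, ∀ y ∈ closedBall a (R * s), ScaledBound L C s⁻¹ (b i) y
  reproduces : ∀ P : RN N → ℝ, PolyLT m P → ∀ y, P y = ∑ i, (∫ z, P z * e i z) * b i y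

lemma exists_scaled_dual_system (N m L : ℕ) (R : ℝ) :
    ∃ (n : ℕ) (C : ℝ), 0 < C ∧ ∀ (a : RN N) (s : ℝ), 0 < s → ∃ b e : Fin n → RN N → ℝ,
      DualSystem m L C R a s b e := by
  obtain ⟨n, b, e, hb, he, hes, hrep⟩ := exists_dual_system N m
  have h1 : ∀ i, ∃ C, 0 < C ∧ ∀ y ∈ closedBall (0 : RN N) R, ScaledBound L C 1 (b i) y := fun i =>
    exists_scaledBound_of_isCompact (hb i).1 L (isCompact_closedBall 0 R)
  have h2 : ∀ i, ∃ C, 0 < C ∧ ∀ y, ScaledBound 0 C 1 (e i) y := fun i =>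
    exists_scaledBound_of_hasCompactSupport (he i)
      (HasCompactSupport.of_support_subset_isCompact (isCompact_closedBall 0 1)
        ((subset_tsupport _).trans (hes i))) 0
  choose Cb hCb hCb' using h1
  choose Ce hCe hCe' using h2
  set C := 1 + ∑ i, (Cb i + Ce i) with hC
  have hpos : ∀ i, 0 ≤ Cb i + Ce i := fun i => (add_pos (hCb i) (hCe i)).le
  have hle : ∀ i, Cb i + Ce i ≤ C := fun i => by
    have := Finset.single_le_sum (f := fun i => Cb i + Ce i) (fun i _ => hpos i)
      (Finset.mem_univ i)
    linarith
  refine ⟨n, C, by have := Finset.sum_nonneg fun i (_ : i ∈ Finset.univ) => hpos i; linarith,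
    fun a s hs => ?_⟩
  have hsm : ∀ u : RN N → ℝ, ContDiff ℝ (⊤ : ℕ∞) u →
      ContDiff ℝ (⊤ : ℕ∞) (fun y => u (s⁻¹ • (y - a))) := fun u hu => by fun_prop
  refine ⟨fun i y => b i (s⁻¹ • (y - a)), fun i y => (s ^ N)⁻¹ * e i (s⁻¹ • (y - a)),
    fun i => hsm _ (hb i).1, fun i => contDiff_const.mul (hsm _ (he i)), fun i => ?_,
    fun i y => ?_, fun i y hy => ?_, fun P hP y => ?_⟩
  · refine closure_minimal (fun y hy => ?_) isClosed_closedBall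
    have : e i (s⁻¹ • (y - a)) ≠ 0 := fun h0 => hy (by simp [h0])
    have := hes i (subset_tsupport _ this)
    rw [mem_closedBall_zero_iff, norm_smul, norm_inv, Real.norm_of_nonneg hs.le,
      inv_mul_le_iff₀ hs, mul_one] at this
    rwa [mem_closedBall, dist_eq_norm]
  · have := hCe' i (s⁻¹ • (y - a)) 0 le_rfl
    rw [norm_iteratedFDeriv_zero, pow_zero, mul_one, Real.norm_eq_abs] at this
    rw [abs_mul, abs_of_pos (by positivity : 0 < (s ^ N)⁻¹), div_eq_inv_mul]
    gcongr
    linarith [hle i, hCb i]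
  · have := hCb' i (s⁻¹ • (y - a)) (by
      rw [mem_closedBall, dist_eq_norm] at hy
      rw [mem_closedBall_zero_iff, norm_smul, norm_inv, Real.norm_of_nonneg hs.le,
        inv_mul_le_iff₀ hs, mul_comm]
      exact hy)
    have h3 := ScaledBound.comp_smul_sub (c := s⁻¹) (hb i).1 this
    rw [abs_of_pos (inv_pos.2 hs)] at h3
    exact h3.mono (hCb i).le (by linarith [hle i, hCe i]) (by positivity) le_rfl
  · have hQ : PolyLT m (fun z => P (s • (z - (-(s⁻¹ • a))))) := hP.comp_affine s _
    have hz : ∀ z : RN N, s • (z - (-(s⁻¹ • a))) = s • z + a := fun z => by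
      rw [sub_neg_eq_add, smul_add, smul_inv_smul₀ hs.ne']
    have := hrep _ hQ (s⁻¹ • (y - a))
    simp only [hz, smul_inv_smul₀ hs.ne', sub_add_cancel] at this
    rw [this]
    refine Finset.sum_congr rfl fun i _ => ?_
    congr 1
    have h4 : ∫ z, P (z + a) * ((s ^ N)⁻¹ * e i (s⁻¹ • z)) =
        ∫ z, P z * ((s ^ N)⁻¹ * e i (s⁻¹ • (z - a))) := by
      rw [← integral_add_right_eq_self (fun z => P z * ((s ^ N)⁻¹ * e i (s⁻¹ • (z - a)))) a]
      simp only [add_sub_cancel_right]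
    rw [← h4]
    have h5 := Measure.integral_comp_smul (volume : Measure (RN N))
      (fun z => P (z + a) * ((s ^ N)⁻¹ * e i (s⁻¹ • z))) s
    simp only [inv_smul_smul₀ hs.ne', finrank_euclideanSpace, Fintype.card_fin,
      smul_eq_mul] at h5
    rw [abs_of_pos (by positivity : 0 < (s ^ N)⁻¹)] at h5
    have h6 : ∫ z, P (s • z + a) * ((s ^ N)⁻¹ * e i z) =
        (s ^ N)⁻¹ * ∫ z, e i z * P (s • z + a) := by
      rw [← integral_const_mul]
      congr 1; ext z; ring
    rw [h6] at h5
    exact mul_left_cancel₀ (by positivity) h5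

end DualSystem

section Atom

variable {m L n : ℕ} {C R A s : ℝ} {a : RN N} {b e : Fin n → RN N → ℝ} {η : RN N → ℝ}
  {f : RN N → ℂ}

/-- The function `η • f`, corrected to have vanishing moments. -/
def corrected (b e : Fin n → RN N → ℝ) (η : RN N → ℝ) (f : RN N → ℂ) (y : RN N) : ℂ :=
  η y • f y - ∑ i, e i y • ∫ z, (η z * b i z) • f z

lemma DualSystem.hasCompactSupport_e (hd : DualSystem m L C R a s b e) (i : Fin n) :
    HasCompactSupport (e i) :=
  HasCompactSupport.of_support_subset_isCompact (isCompact_closedBall a s)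
    ((subset_tsupport _).trans (hd.tsupport_e i))

lemma DualSystem.integral_smul_corrected (hd : DualSystem m L C R a s b e)
    (hη : Continuous η) (hf : Continuous f) (hfc : HasCompactSupport f) {Φ : RN N → ℝ}
    (hΦ : Continuous Φ) :
    ∫ y, Φ y • corrected b e η f y =
      (∫ y, (η y * Φ y) • f y) - ∑ i, (∫ y, Φ y * e i y) • ∫ z, (η z * b i z) • f z := by
  have h1 : ∀ y, Φ y • corrected b e η f y =
      (η y * Φ y) • f y - ∑ i, (Φ y * e i y) • ∫ z, (η z * b i z) • f z := fun y => by
    rw [corrected, smul_sub, Finset.smul_sum, smul_smul, mul_comm]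
    simp only [smul_smul]
  have hi1 : ∀ i, Integrable (fun y => Φ y * e i y) := fun i =>
    (hΦ.mul (hd.smooth_e i).continuous).integrable_of_hasCompactSupport
      (hd.hasCompactSupport_e i).mul_left
  simp only [h1]
  rw [integral_sub, integral_finsetSum]
  · simp only [integral_smul_const]
  · exact fun i _ => (hi1 i).smul_const _
  · exact ((hη.mul hΦ).smul hf).integrable_of_hasCompactSupport hfc.smul_left
  · exact integrable_finsetSum _ fun i _ => (hi1 i).smul_const _

lemma DualSystem.integral_smul_corrected' (hd : DualSystem m L C R a s b e)
    (hη : Continuous η) (hf : Continuous f) (hfc : HasCompactSupport f) {Φ : RN N → ℝ}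
    (hΦ : Continuous Φ) :
    ∫ y, Φ y • corrected b e η f y =
      ∫ y, (η y * (Φ y - ∑ i, (∫ z, Φ z * e i z) * b i y)) • f y := by
  rw [hd.integral_smul_corrected hη hf hfc hΦ]
  have hi : ∀ i, Integrable (fun y => (η y * b i y) • f y) := fun i =>
    ((hη.mul (hd.smooth_b i).continuous).smul hf).integrable_of_hasCompactSupport hfc.smul_left
  have h1 : ∀ y, (η y * (Φ y - ∑ i, (∫ z, Φ z * e i z) * b i y)) • f y =
      (η y * Φ y) • f y - ∑ i, (∫ z, Φ z * e i z) • ((η y * b i y) • f y) := fun y => by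
    simp only [smul_smul]
    rw [← Finset.sum_smul, ← sub_smul]
    congr 1
    rw [mul_sub, Finset.mul_sum]
    congr 1
    exact Finset.sum_congr rfl fun i _ => by ring
  simp only [h1]
  rw [integral_sub, integral_finsetSum]
  · simp only [integral_smul]
  · exact fun i _ => (hi i).smul (∫ z, Φ z * e i z)
  · exact ((hη.mul hΦ).smul hf).integrable_of_hasCompactSupport hfc.smul_left
  · exact integrable_finsetSum _ fun i _ => (hi i).smul (∫ z, Φ z * e i z)

lemma DualSystem.integral_polyLT_smul_corrected (hd : DualSystem m L C R a s b e)
    (hη : Continuous η) (hf : Continuous f) (hfc : HasCompactSupport f) {P : RN N → ℝ}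
    (hP : PolyLT m P) : ∫ y, P y • corrected b e η f y = 0 := by
  rw [hd.integral_smul_corrected' hη hf hfc hP.1.continuous]
  simp only [← hd.reproduces P hP, sub_self, mul_zero, zero_smul, integral_zero]

/-- A smooth cutoff `η` adapted to the ball of centre `a` and radius `R * s`. -/
structure AdaptedCutoff (L : ℕ) (A R : ℝ) (a : RN N) (s : ℝ) (η : RN N → ℝ) : Prop where
  smooth : ContDiff ℝ (⊤ : ℕ∞) η
  tsupport_subset : tsupport η ⊆ closedBall a (R * s)
  bound : ∀ y, ScaledBound L A s⁻¹ η y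

lemma AdaptedCutoff.integral_le (hη : AdaptedCutoff L A R a s η) (hs : 0 < s) (hR : 1 ≤ R)
    (hA : 0 < A) {u : RN N → ℝ} (hu : ContDiff ℝ (⊤ : ℕ∞) u) {D : ℝ} (hD : 0 < D)
    (hb : ∀ y ∈ closedBall a (R * s), ScaledBound L D s⁻¹ u y) {K : ℝ} (hK : 0 ≤ K)
    {x : RN N} (hx : dist x a ≤ K * s) :
    ENNReal.ofReal ‖∫ y, (η y * u y) • f y‖ ≤
      ENNReal.ofReal (2 ^ L * A * D * s ^ N * (K + R + 1) ^ (N + L)) * grandMax L f x := by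
  have hts : tsupport (fun y => η y * u y) ⊆ tsupport η := tsupport_mul_subset_left
  refine le_grandMax (hη.smooth.mul hu) (by positivity) (by linarith) hs ?_ fun j hj z => ?_
  · refine (hts.trans hη.tsupport_subset).trans fun y hy => ?_
    rw [mem_closedBall] at hy
    rw [mem_ball]
    have := dist_triangle_right y x a
    nlinarith
  · have h : ScaledBound L (2 ^ L * A * D) s⁻¹ (fun y => η y * u y) z := by
      by_cases hz : z ∈ tsupport η
      · exact (hη.bound z).mul (hb z (hη.tsupport_subset hz)) hη.smooth hu hA.le hD.le
          (by positivity)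
      · exact scaledBound_of_notMem_tsupport (fun h => hz (hts h)) (by positivity) (by positivity)
    refine (h j hj).trans_eq ?_
    rw [pow_add, inv_pow]
    field_simp

lemma ScaledBound.abs_le {J : ℕ} {A r : ℝ} {u : RN N → ℝ} {y : RN N}
    (h : ScaledBound J A r u y) : |u y| ≤ A := by
  simpa using h 0 (Nat.zero_le _)

/-- The volume of the unit ball. -/
abbrev ballVol (N : ℕ) : ℝ := (volume : Measure (RN N)).real (ball 0 1)

lemma DualSystem.abs_integral_mul_le (hd : DualSystem m L C R a s b e) (hs : 0 < s)
    (i : Fin n) {Φ : RN N → ℝ} {D : ℝ} (hD : 0 ≤ D)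
    (hb : ∀ y ∈ closedBall a s, |Φ y| ≤ D) :
    |∫ z, Φ z * e i z| ≤ D * C * ballVol N := by
  have := norm_integral_le_of_tsupport (u := fun z => Φ z * e i z) (D := D * (C / s ^ N)) hs
    (fun y hy => hd.tsupport_e i (subset_tsupport _ fun h0 => hy (by simp [h0])))
    (fun y hy => by
      rw [Real.norm_eq_abs, abs_mul]
      exact mul_le_mul (hb y hy) (hd.abs_e_le i y) (abs_nonneg _) hD)
  rw [Real.norm_eq_abs] at this
  refine this.trans_eq ?_
  field_simp

lemma DualSystem.integral_corrected_le (hd : DualSystem m L C R a s b e)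
    (hη : AdaptedCutoff L A R a s η) (hs : 0 < s) (hR : 1 ≤ R) (hC : 0 < C)
    (hA : 0 < A) (hf : Continuous f) (hfc : HasCompactSupport f)
    {u : RN N → ℝ} (hu : ContDiff ℝ (⊤ : ℕ∞) u) {D : ℝ} (hD : 0 < D)
    (hb : ∀ y ∈ closedBall a (R * s), ScaledBound L D s⁻¹ u y) {K : ℝ} (hK : 0 ≤ K)
    {x : RN N} (hx : dist x a ≤ K * s) :
    ENNReal.ofReal ‖∫ y, u y • corrected b e η f y‖ ≤
      ENNReal.ofReal (2 ^ L * A * (1 + n * (C * ballVol N * C)) * (K + R + 1) ^ (N + L) *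
        (D * s ^ N)) * grandMax L f x := by
  rw [hd.integral_smul_corrected' hη.smooth.continuous hf hfc hu.continuous]
  have hV : 0 ≤ ballVol N := measureReal_nonneg
  have hsub : closedBall a s ⊆ closedBall a (R * s) := closedBall_subset_closedBall (by nlinarith)
  have hsb : ∀ i, ContDiff ℝ (⊤ : ℕ∞) (fun y => (∫ z, u z * e i z) * b i y) := fun i =>
    contDiff_const.mul (hd.smooth_b i)
  have h := hη.integral_le (f := f) hs hR hA (D := D + n * (D * C * ballVol N * C))
    (u := fun y => u y - ∑ i, (∫ z, u z * e i z) * b i y)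
    (hu.sub (ContDiff.sum fun i _ => hsb i)) (by positivity)
    (fun y hy => (hb y hy).sub (ScaledBound.sum (fun i => (hd.bound_b i y hy).const_mul
      (hd.smooth_b i) (hd.abs_integral_mul_le hs i hD.le fun y hy => (hb y (hsub hy)).abs_le))
      hsb) hu (ContDiff.sum fun i _ => hsb i)) hK hx
  refine h.trans_eq ?_
  congr 2
  ring

lemma DualSystem.coefficient_le (hd : DualSystem m L C R a s b e)
    (hη : AdaptedCutoff L A R a s η) (hs : 0 < s) (hR : 1 ≤ R) (hC : 0 < C)
    (hA : 0 < A) {K : ℝ} (hK : 0 ≤ K) {x : RN N} (hx : dist x a ≤ K * s) (i : Fin n) :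
    ENNReal.ofReal ‖∫ z, (η z * b i z) • f z‖ ≤
      ENNReal.ofReal (2 ^ L * A * C * s ^ N * (K + R + 1) ^ (N + L)) * grandMax L f x :=
  hη.integral_le hs hR hA (hd.smooth_b i) hC (hd.bound_b i) hK hx

lemma ofReal_norm_sum_smul_le {n : ℕ} {c : Fin n → ℝ} {v : Fin n → ℂ} {B D : ℝ} {G : ℝ≥0∞}
    (hB : 0 ≤ B) (hc : ∀ i, |c i| ≤ B)
    (hv : ∀ i, ENNReal.ofReal ‖v i‖ ≤ ENNReal.ofReal D * G) :
    ENNReal.ofReal ‖∑ i, c i • v i‖ ≤ ENNReal.ofReal (n * (B * D)) * G := by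
  calc ENNReal.ofReal ‖∑ i, c i • v i‖ ≤ ENNReal.ofReal (∑ i, B * ‖v i‖) := by
        refine ENNReal.ofReal_le_ofReal ((norm_sum_le _ _).trans (Finset.sum_le_sum fun i _ => ?_))
        rw [norm_smul, Real.norm_eq_abs]
        gcongr
        exact hc i
    _ = ∑ i, ENNReal.ofReal B * ENNReal.ofReal ‖v i‖ := by
        rw [ENNReal.ofReal_sum_of_nonneg fun i _ => by positivity]
        simp only [ENNReal.ofReal_mul hB]
    _ ≤ ∑ _i : Fin n, ENNReal.ofReal B * (ENNReal.ofReal D * G) := by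
        gcongr with i
        exact hv i
    _ = _ := by
        rw [Finset.sum_const, Finset.card_univ, Fintype.card_fin, nsmul_eq_mul,
          ENNReal.ofReal_mul (by positivity), ENNReal.ofReal_mul hB, ENNReal.ofReal_natCast]
        ring

end Atom

section MaximalBound

variable {m L n : ℕ} {C R A K : ℝ} {φ : RN N → ℝ}

lemma DualSystem.corrected_parts_eq_zero {a : RN N} {s : ℝ} {b e : Fin n → RN N → ℝ}
    {η : RN N → ℝ} (hd : DualSystem m L C R a s b e) (hη : AdaptedCutoff L A R a s η) (hs : 0 < s)
    (hR : 1 ≤ R) {y : RN N} (hy : y ∉ closedBall a (R * s)) : η y = 0 ∧ ∀ i, e i y = 0 := by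
  refine ⟨by_contra fun h => hy (hη.tsupport_subset (subset_tsupport _ h)),
    fun i => by_contra fun h => hy (closedBall_subset_closedBall ?_
      (hd.tsupport_e i (subset_tsupport _ h)))⟩
  nlinarith

lemma DualSystem.tsupport_corrected {a : RN N} {s : ℝ} {b e : Fin n → RN N → ℝ} {η : RN N → ℝ}
    {f : RN N → ℂ} (hd : DualSystem m L C R a s b e) (hη : AdaptedCutoff L A R a s η) (hs : 0 < s)
    (hR : 1 ≤ R) : tsupport (corrected b e η f) ⊆ closedBall a (R * s) := by
  refine closure_minimal (fun y hy => ?_) isClosed_closedBall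
  by_contra hya
  obtain ⟨h1, h2⟩ := hd.corrected_parts_eq_zero hη hs hR hya
  exact hy (by simp [corrected, h1, h2])

lemma exists_near_bound (hφ : GoodPhi φ) (m L n : ℕ) (hC : 0 < C) (hR : 1 ≤ R) (hA : 0 < A)
    (hK : 0 ≤ K) : ∃ B, 0 < B ∧ ∀ {a : RN N} {s : ℝ} {b e : Fin n → RN N → ℝ} {η : RN N → ℝ}
      {f : RN N → ℂ}, 0 < s → DualSystem m L C R a s b e → AdaptedCutoff L A R a s η →
      Continuous f → HasCompactSupport f → ∀ x, dist x a ≤ K * s → ∀ t > 0,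
      ENNReal.ofReal ‖convAt φ t (corrected b e η f) x‖ ≤ ENNReal.ofReal B * grandMax L f x := by
  obtain ⟨Cφ, hCφ, hdil⟩ := exists_dil_bound hφ L
  have hV : 0 ≤ ballVol N := measureReal_nonneg
  set B₁ := 2 ^ L * A * (1 + n * (C * ballVol N * C)) * (K + R + 1) ^ (N + L) * Cφ with hB₁
  set B₂ := 2 ^ L * A * Cφ * 2 ^ (N + L) with hB₂
  set B₃ := n * (Cφ * C * ballVol N * (2 ^ L * A * C * (K + R + 1) ^ (N + L))) with hB₃
  have hB₁' : 0 < B₁ := by positivity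
  have hB₂' : 0 < B₂ := by positivity
  have hB₃' : 0 ≤ B₃ := by positivity
  refine ⟨B₁ + (B₂ + B₃), by positivity, ?_⟩
  intro a s b e η f hs hd hη hf hfc x hx t ht
  obtain ⟨hΦ, hΦs, hΦb⟩ := hdil t ht x
  rw [convAt]
  rcases le_or_gt s t with hst | hst
  · have h := hd.integral_corrected_le hη hs hR hC hA hf hfc hΦ (D := Cφ / s ^ N)
      (by positivity) (fun y _ => (hΦb y).mono (by positivity) (by gcongr) (by positivity)
        (by gcongr)) hK hx
    refine h.trans ?_
    gcongr
    rw [div_mul_cancel₀ _ (by positivity)]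
    linarith
  · rw [hd.integral_smul_corrected hη.smooth.continuous hf hfc hΦ.continuous]
    have h1 : ENNReal.ofReal ‖∫ y, (η y * dil φ t (x - y)) • f y‖ ≤
        ENNReal.ofReal B₂ * grandMax L f x := by
      refine le_grandMax (hη.smooth.mul hΦ) (by positivity) one_le_two ht ?_ fun j hj z => ?_
      · refine (tsupport_mul_subset_right.trans hΦs).trans (closedBall_subset_ball (by linarith))
      · refine (((hη.bound z).mono hA.le le_rfl (by positivity)
          (by gcongr : s⁻¹ ≤ t⁻¹)).mul (hΦb z) hη.smooth hΦ hA.le (by positivity)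
          (by positivity) j hj).trans_eq ?_
        rw [pow_add, inv_pow]
        field_simp
    have h2 : ENNReal.ofReal ‖∑ i, (∫ y, dil φ t (x - y) * e i y) • ∫ z, (η z * b i z) • f z‖ ≤
        ENNReal.ofReal B₃ * grandMax L f x := by
      refine (ofReal_norm_sum_smul_le (B := Cφ * C * ballVol N / s ^ N) (by positivity)
        (fun i => ?_) (fun i => hd.coefficient_le hη hs hR hC hA hK hx i)).trans_eq ?_
      · have := norm_integral_le_of_tsupport (u := fun y => dil φ t (x - y) * e i y)
          (D := Cφ / t ^ N * (C / s ^ N)) ht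
          (fun y hy => hΦs (subset_tsupport _ (left_ne_zero_of_mul hy)))
          (fun y _ => by
            rw [Real.norm_eq_abs, abs_mul]
            exact mul_le_mul (hΦb y).abs_le (hd.abs_e_le i y) (abs_nonneg _) (by positivity))
        rw [Real.norm_eq_abs] at this
        refine this.trans_eq ?_
        field_simp
      · congr 2
        rw [hB₃]
        field_simp
    calc _ ≤ ENNReal.ofReal (‖∫ y, (η y * dil φ t (x - y)) • f y‖ +
          ‖∑ i, (∫ y, dil φ t (x - y) * e i y) • ∫ z, (η z * b i z) • f z‖) :=
          ENNReal.ofReal_le_ofReal (norm_sub_le _ _)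
      _ ≤ ENNReal.ofReal B₂ * grandMax L f x + ENNReal.ofReal B₃ * grandMax L f x := by
          rw [ENNReal.ofReal_add (norm_nonneg _) (norm_nonneg _)]
          exact add_le_add h1 h2
      _ = ENNReal.ofReal (B₂ + B₃) * grandMax L f x := by
          rw [← add_mul, ENNReal.ofReal_add hB₂'.le hB₃']
      _ ≤ _ := by
          exact mul_le_mul' (ENNReal.ofReal_le_ofReal (le_add_of_nonneg_left hB₁'.le)) le_rfl

/-- Derivatives of the Taylor remainder of a kernel that varies at scale `t`, on a ball of
radius `R * s` with `s ≤ t`. -/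
lemma scaledBound_taylor_remainder {Φ T : RN N → ℝ} {a : RN N} {s t D : ℝ}
    (hs : 0 < s) (hst : s ≤ t) (hR : 1 ≤ R) (hD : 0 ≤ D) (hΦ : ContDiff ℝ (⊤ : ℕ∞) Φ)
    (hΦb : ∀ y, ScaledBound (max L m) D t⁻¹ Φ y) (hT : PolyLT m T)
    (hTa : ∀ j < m, iteratedFDeriv ℝ j T a = iteratedFDeriv ℝ j Φ a) :
    ∀ y ∈ closedBall a (R * s),
      ScaledBound L (D * R ^ m * (s / t) ^ m) s⁻¹ (fun y => Φ y - T y) y := by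
  have ht : 0 < t := hs.trans_le hst
  have hsub : ∀ j y, iteratedFDeriv ℝ j (fun y => Φ y - T y) y =
      iteratedFDeriv ℝ j Φ y - iteratedFDeriv ℝ j T y := fun j y =>
    iteratedFDeriv_sub_apply (hΦ.of_le (by exact_mod_cast le_top)).contDiffAt
      (hT.1.of_le (by exact_mod_cast le_top)).contDiffAt
  have hRm : 1 ≤ R ^ m := one_le_pow₀ hR
  intro y hy j hj
  rcases le_or_gt j m with hjm | hjm
  · have := norm_iteratedFDeriv_le_of_vanish (hΦ.sub hT.1) (m := m) (a := a) (ρ := R * s)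
      (B := D * t⁻¹ ^ m) (by positivity)
      (fun j hj => by rw [hsub, hTa j hj, sub_self])
      (fun y _ => by
        rw [hsub, hT.2 m le_rfl, sub_zero]
        exact hΦb y m (le_max_right _ _)) (m - j) (Nat.sub_le _ _) y hy
    rw [Nat.sub_sub_self hjm] at this
    refine this.trans ?_
    calc D * t⁻¹ ^ m * (R * s) ^ (m - j)
        = D * R ^ (m - j) * (t⁻¹ ^ m * s ^ (m - j)) := by rw [mul_pow]; ring
      _ ≤ D * R ^ m * (t⁻¹ ^ m * s ^ (m - j)) := by gcongr; exact Nat.sub_le _ _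
      _ = _ := by
        have : s ^ m = s ^ (m - j) * s ^ j := by rw [← pow_add, Nat.sub_add_cancel hjm]
        rw [div_pow, this, inv_pow, inv_pow]
        field_simp
  · rw [hsub, hT.2 j hjm.le, sub_zero]
    refine (hΦb y j (hj.trans (le_max_left _ _))).trans ?_
    have h1 : (s / t) ^ j ≤ (s / t) ^ m :=
      pow_le_pow_of_le_one (by positivity) ((div_le_one ht).2 hst) hjm.le
    calc D * t⁻¹ ^ j = D * 1 * (s / t) ^ j * s⁻¹ ^ j := by
          rw [mul_one, mul_assoc, ← mul_pow]
          congr 2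
          field_simp
      _ ≤ _ := by gcongr

lemma exists_far_bound (hφ : GoodPhi φ) (m L n : ℕ) (hC : 0 < C) (hR : 1 ≤ R) (hA : 0 < A)
    (hK : 0 ≤ K) : ∃ B, 0 < B ∧ ∀ {a : RN N} {s : ℝ} {b e : Fin n → RN N → ℝ} {η : RN N → ℝ}
      {f : RN N → ℂ}, 0 < s → DualSystem m L C R a s b e → AdaptedCutoff L A R a s η →
      Continuous f → HasCompactSupport f → ∀ x x', 2 * (R * s) < dist x a → dist x' a ≤ K * s →
      ∀ t > 0, ENNReal.ofReal ‖convAt φ t (corrected b e η f) x‖ ≤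
        ENNReal.ofReal (B * (s / dist x a) ^ (N + m)) * grandMax L f x' := by
  obtain ⟨Cφ, hCφ, hdil⟩ := exists_dil_bound hφ (max L m)
  have hV : 0 ≤ ballVol N := measureReal_nonneg
  refine ⟨2 ^ L * A * (1 + n * (C * ballVol N * C)) * (K + R + 1) ^ (N + L) *
    (Cφ * R ^ m * 2 ^ (N + m)), by positivity, ?_⟩
  intro a s b e η f hs hd hη hf hfc x x' hx hx' t ht
  obtain ⟨hΦ, hΦs, hΦb⟩ := hdil t ht x
  have hRs : s ≤ R * s := by nlinarith
  rw [convAt]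
  rcases lt_or_ge t (dist x a / 2) with htx | htx
  · have : ∀ y, dil φ t (x - y) • corrected b e η f y = 0 := fun y => by
      by_cases hy : dil φ t (x - y) = 0
      · rw [hy, zero_smul]
      · have hyt : dist y x ≤ t := hΦs (subset_tsupport _ hy)
        have hya : R * s < dist y a := by
          have := dist_triangle_left x a y
          linarith
        obtain ⟨h1, h2⟩ := hd.corrected_parts_eq_zero hη hs hR
          (fun h => hya.not_ge (mem_closedBall.1 h))
        simp [corrected, h1, h2]
    simp [this]
  · have hst : s ≤ t := by linarith
    have hdpos : 0 < dist x a := by linarith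
    obtain ⟨T, hT, hTa⟩ := exists_taylor hΦ m a
    have hrem := scaledBound_taylor_remainder (L := L) hs hst hR (by positivity) hΦ hΦb hT hTa
    have h := hd.integral_corrected_le hη hs hR hC hA hf hfc (hΦ.sub hT.1)
      (by positivity) hrem hK hx'
    have hzero := hd.integral_polyLT_smul_corrected hη.smooth.continuous hf hfc hT
    have hcc : HasCompactSupport (corrected b e η f) :=
      HasCompactSupport.of_support_subset_isCompact (isCompact_closedBall a (R * s))
        ((subset_tsupport _).trans (hd.tsupport_corrected hη hs hR))
    have hcont : Continuous (corrected b e η f) :=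
      (hη.smooth.continuous.smul hf).sub (continuous_finsetSum _ fun i _ =>
        (hd.smooth_e i).continuous.smul continuous_const)
    have heq : ∫ y, dil φ t (x - y) • corrected b e η f y =
        ∫ y, (dil φ t (x - y) - T y) • corrected b e η f y := by
      simp only [sub_smul]
      rw [integral_sub, hzero, sub_zero]
      · exact (hΦ.continuous.smul hcont).integrable_of_hasCompactSupport hcc.smul_left
      · exact (hT.1.continuous.smul hcont).integrable_of_hasCompactSupport hcc.smul_left
    rw [heq]
    refine h.trans ?_
    gcongr ENNReal.ofReal ?_ * _
    rw [mul_assoc _ (Cφ * R ^ m * 2 ^ (N + m))]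
    refine mul_le_mul_of_nonneg_left ?_ (by positivity)
    calc Cφ / t ^ N * R ^ m * (s / t) ^ m * s ^ N = Cφ * R ^ m * (s / t) ^ (N + m) := by
          rw [div_pow, div_pow, pow_add, pow_add]
          field_simp
      _ ≤ Cφ * R ^ m * (s / (dist x a / 2)) ^ (N + m) := by gcongr
      _ = _ := by
          rw [show s / (dist x a / 2) = 2 * (s / dist x a) by field_simp, mul_pow]
          ring

end MaximalBound

section Atoms

lemma dist_le_of_mem_cube {c y : RN N} {ℓ : ℝ} (hℓ : 0 ≤ ℓ) (h : y ∈ cube c ℓ) :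
    dist y c ≤ N * (ℓ / 2) := by
  rw [EuclideanSpace.dist_eq, Real.sqrt_le_left (by positivity)]
  calc ∑ i, dist (y i) (c i) ^ 2 ≤ ∑ _i : Fin N, (ℓ / 2) ^ 2 := by
        refine Finset.sum_le_sum fun i _ => ?_
        rw [Real.dist_eq]
        exact pow_le_pow_left₀ (abs_nonneg _) (h i) 2
    _ = N * (ℓ / 2) ^ 2 := by simp
    _ ≤ (N : ℝ) ^ 2 * (ℓ / 2) ^ 2 := by
        gcongr
        exact_mod_cast Nat.le_self_pow two_ne_zero N
    _ = _ := by ring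

lemma mem_cube_of_dist_le {c y : RN N} {ℓ : ℝ} (h : dist y c ≤ ℓ / 2) : y ∈ cube c ℓ := fun i => by
  have := PiLp.norm_apply_le (y - c) i
  rw [dist_eq_norm] at h
  simpa using this.trans h

lemma isClosed_cube (c : RN N) (ℓ : ℝ) : IsClosed (cube c ℓ) := by
  have : cube c ℓ = ⋂ i, {y : RN N | |y i - c i| ≤ ℓ / 2} := by
    ext y; simp [cube]
  rw [this]
  exact isClosed_iInter fun i => isClosed_le (by fun_prop) continuous_const

lemma lintegral_comp_inv_smul_sub (F : RN N → ℝ≥0∞) (hF : Measurable F) (a : RN N) {s : ℝ}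
    (hs : 0 < s) : ∫⁻ x, F (s⁻¹ • (x - a)) = ENNReal.ofReal (s ^ N) * ∫⁻ x, F x := by
  rw [lintegral_sub_right_eq_self (fun x => F (s⁻¹ • x)) a]
  have h := lintegral_map (μ := (volume : Measure (RN N))) hF (g := fun x => s⁻¹ • x)
    (measurable_const_smul _)
  rw [← h, Measure.map_addHaar_smul _ (inv_ne_zero hs.ne'), lintegral_smul_measure]
  simp [abs_of_pos hs]

lemma exists_tail_integral_bound (N m : ℕ) {p R : ℝ} (hR : 1 ≤ R) (hp : 0 < p)
    (hpN : (N : ℝ) < (N + m) * p) : ∃ B, 0 < B ∧ ∀ (a : RN N) (s : ℝ), 0 < s →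
      ∫⁻ x in (cube a (4 * (R * s)))ᶜ, ENNReal.ofReal ((s / dist x a) ^ (N + m)) ^ p ≤
        ENNReal.ofReal B * ENNReal.ofReal (s ^ N) := by
  set r : ℝ := (N + m) * p with hr
  have hr0 : 0 < r := (Nat.cast_nonneg N).trans_lt hpN
  have hfin := finite_integral_one_add_norm (μ := (volume : Measure (RN N))) (r := r)
    (by simpa using hpN)
  set I := ∫⁻ x : RN N, ENNReal.ofReal ((1 + ‖x‖) ^ (-r)) with hI
  refine ⟨2 ^ r * (I.toReal + 1), by positivity, fun a s hs => ?_⟩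
  calc ∫⁻ x in (cube a (4 * (R * s)))ᶜ, ENNReal.ofReal ((s / dist x a) ^ (N + m)) ^ p
      ≤ ∫⁻ x in (cube a (4 * (R * s)))ᶜ, ENNReal.ofReal (2 ^ r) *
          ENNReal.ofReal ((1 + ‖s⁻¹ • (x - a)‖) ^ (-r)) := by
        refine setLIntegral_mono' (isClosed_cube _ _).measurableSet.compl fun x hx => ?_
        have hx' : 2 * (R * s) < dist x a := by
          by_contra! h
          exact hx (mem_cube_of_dist_le (by linarith))
        have hsd : s ≤ dist x a := by nlinarith
        have hd : 0 < dist x a := hs.trans_le hsd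
        rw [ENNReal.ofReal_rpow_of_nonneg (by positivity) hp.le,
          ← ENNReal.ofReal_mul (by positivity)]
        refine ENNReal.ofReal_le_ofReal ?_
        rw [← Real.rpow_natCast, ← Real.rpow_mul (by positivity), Nat.cast_add, ← hr,
          Real.rpow_neg (by positivity), ← Real.inv_rpow (by positivity),
          ← Real.mul_rpow (by positivity) (by positivity)]
        refine Real.rpow_le_rpow (by positivity) ?_ hr0.le
        rw [norm_smul, norm_inv, Real.norm_of_nonneg hs.le, ← dist_eq_norm,
          ← div_eq_mul_inv, div_le_div_iff₀ hd (by positivity)]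
        rw [mul_add, ← mul_assoc, mul_inv_cancel₀ hs.ne']
        linarith
    _ ≤ ∫⁻ x, ENNReal.ofReal (2 ^ r) * ENNReal.ofReal ((1 + ‖s⁻¹ • (x - a)‖) ^ (-r)) :=
        setLIntegral_le_lintegral _ _
    _ = ENNReal.ofReal (2 ^ r) * (ENNReal.ofReal (s ^ N) * I) := by
        rw [lintegral_const_mul' _ _ ENNReal.ofReal_ne_top,
          lintegral_comp_inv_smul_sub (fun x => ENNReal.ofReal ((1 + ‖x‖) ^ (-r)))
            (by fun_prop) a hs]
    _ ≤ _ := by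
        rw [ENNReal.ofReal_mul (by positivity), mul_assoc, mul_comm (ENNReal.ofReal (s ^ N))]
        gcongr
        exact (ENNReal.ofReal_toReal hfin.ne).symm.le.trans
          (ENNReal.ofReal_le_ofReal (by linarith))

/-- Localized pieces of `f`, corrected to have vanishing moments. -/
lemma exists_atoms {φ : RN N → ℝ} (hφ : GoodPhi φ) (m L : ℕ) {A K R p : ℝ} (hR : 1 ≤ R)
    (hA : 0 < A) (hK : 0 ≤ K) (hp : 0 < p) (hpN : (N : ℝ) < (N + m) * p) :
    ∃ B, 0 < B ∧ ∀ (a : RN N) (s : ℝ) (η : RN N → ℝ) (f : RN N → ℂ) (x' : RN N), 0 < s →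
      AdaptedCutoff L A R a s η → ContDiff ℝ (⊤ : ℕ∞) f → HasCompactSupport f →
      dist x' a ≤ K * s → ∃ β h : RN N → ℂ,
        (∀ y, η y • f y = β y + h y) ∧ ContDiff ℝ (⊤ : ℕ∞) β ∧ Continuous h ∧
        tsupport β ⊆ closedBall a (R * s) ∧ (∀ y ∉ closedBall a (R * s), h y = 0) ∧
        (∀ y, ENNReal.ofReal ‖h y‖ ≤ ENNReal.ofReal B * grandMax L f x') ∧
        (∀ P : RN N → ℝ, PolyLT m P → ∫ y, P y • β y = 0) ∧
        ∫⁻ x, (⨆ (t : ℝ) (_ : 0 < t), ENNReal.ofReal ‖convAt φ t β x‖) ^ p ≤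
          ENNReal.ofReal B * ((∫⁻ x in cube a (4 * (R * s)), grandMax L f x ^ p) +
            ENNReal.ofReal (s ^ N) * grandMax L f x' ^ p) := by
  obtain ⟨n, C, hC, hdual⟩ := exists_scaled_dual_system N m L R
  obtain ⟨B₁, hB₁, hnear⟩ := exists_near_bound hφ m L n hC hR hA
    (K := N * (2 * R)) (by positivity)
  obtain ⟨B₂, hB₂, hfar⟩ := exists_far_bound hφ m L n hC hR hA hK
  obtain ⟨B₃, hB₃, htail⟩ := exists_tail_integral_bound N m hR hp hpN
  set B₄ := n * (C * (2 ^ L * A * C * (K + R + 1) ^ (N + L))) with hB₄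
  have hB₄' : 0 ≤ B₄ := by positivity
  refine ⟨B₁ ^ p + B₂ ^ p * B₃ + B₄, by positivity, ?_⟩
  intro a s η f x' hs hη hf hfc hx'
  obtain ⟨b, e, hd⟩ := hdual a s hs
  refine ⟨corrected b e η f, fun y => ∑ i, e i y • ∫ z, (η z * b i z) • f z, fun y => ?_, ?_, ?_,
    hd.tsupport_corrected hη hs hR, fun y hy => ?_, fun y => ?_, fun P hP =>
      hd.integral_polyLT_smul_corrected hη.smooth.continuous hf.continuous hfc hP, ?_⟩
  · rw [corrected, sub_add_cancel]
  · exact (hη.smooth.smul hf).sub (ContDiff.sum fun i _ => (hd.smooth_e i).smul contDiff_const)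
  · exact continuous_finsetSum _ fun i _ => (hd.smooth_e i).continuous.smul continuous_const
  · simp [(hd.corrected_parts_eq_zero hη hs hR hy).2]
  · refine (ofReal_norm_sum_smul_le (by positivity) (fun i => hd.abs_e_le i y)
      (fun i => hd.coefficient_le hη hs hR hC hA hK hx' i)).trans ?_
    gcongr
    have : n * (C / s ^ N * (2 ^ L * A * C * s ^ N * (K + R + 1) ^ (N + L))) = B₄ := by
      rw [hB₄]
      field_simp
    rw [this]
    exact le_add_of_nonneg_left (by positivity)
  · rw [← lintegral_add_compl _ (isClosed_cube a (4 * (R * s))).measurableSet]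
    have h1 : ∫⁻ x in cube a (4 * (R * s)),
        (⨆ (t : ℝ) (_ : 0 < t), ENNReal.ofReal ‖convAt φ t (corrected b e η f) x‖) ^ p ≤
        ENNReal.ofReal (B₁ ^ p) * ∫⁻ x in cube a (4 * (R * s)), grandMax L f x ^ p := by
      rw [← lintegral_const_mul' _ _ ENNReal.ofReal_ne_top]
      refine setLIntegral_mono' (isClosed_cube _ _).measurableSet fun x hx => ?_
      rw [← ENNReal.ofReal_rpow_of_pos hB₁, ← ENNReal.mul_rpow_of_nonneg _ _ hp.le]
      refine ENNReal.rpow_le_rpow (iSup₂_le fun t ht => ?_) hp.le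
      refine hnear hs hd hη hf.continuous hfc x ?_ t ht
      have := dist_le_of_mem_cube (by positivity) hx
      linarith
    have h2 : ∫⁻ x in (cube a (4 * (R * s)))ᶜ,
        (⨆ (t : ℝ) (_ : 0 < t), ENNReal.ofReal ‖convAt φ t (corrected b e η f) x‖) ^ p ≤
        ENNReal.ofReal (B₂ ^ p * B₃) * (ENNReal.ofReal (s ^ N) * grandMax L f x' ^ p) := by
      calc _ ≤ ∫⁻ x in (cube a (4 * (R * s)))ᶜ, ENNReal.ofReal (B₂ ^ p) *
            (ENNReal.ofReal ((s / dist x a) ^ (N + m)) ^ p) * grandMax L f x' ^ p := by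
            refine setLIntegral_mono' (isClosed_cube _ _).measurableSet.compl fun x hx => ?_
            rw [← ENNReal.ofReal_rpow_of_pos hB₂, ← ENNReal.mul_rpow_of_nonneg _ _ hp.le,
              ← ENNReal.mul_rpow_of_nonneg _ _ hp.le, ← ENNReal.ofReal_mul hB₂.le]
            refine ENNReal.rpow_le_rpow (iSup₂_le fun t ht => ?_) hp.le
            refine hfar hs hd hη hf.continuous hfc x x' ?_ hx' t ht
            by_contra! h
            exact hx (mem_cube_of_dist_le (by linarith))
        _ = ENNReal.ofReal (B₂ ^ p) * (∫⁻ x in (cube a (4 * (R * s)))ᶜ,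
            ENNReal.ofReal ((s / dist x a) ^ (N + m)) ^ p) * grandMax L f x' ^ p := by
            rw [lintegral_mul_const _ (by fun_prop),
              lintegral_const_mul' _ _ ENNReal.ofReal_ne_top]
        _ ≤ ENNReal.ofReal (B₂ ^ p) * (ENNReal.ofReal B₃ * ENNReal.ofReal (s ^ N)) *
            grandMax L f x' ^ p := by
            gcongr
            exact htail a s hs
        _ = _ := by
            rw [ENNReal.ofReal_mul (by positivity)]
            ring
    refine (add_le_add h1 h2).trans ?_
    rw [mul_add]
    have e1 : B₁ ^ p ≤ B₁ ^ p + B₂ ^ p * B₃ + B₄ := by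
      have : 0 ≤ B₂ ^ p * B₃ := by positivity
      linarith
    have e2 : B₂ ^ p * B₃ ≤ B₁ ^ p + B₂ ^ p * B₃ + B₄ := by
      have : 0 ≤ B₁ ^ p := by positivity
      linarith
    exact add_le_add (mul_le_mul' (ENNReal.ofReal_le_ofReal e1) le_rfl)
      (mul_le_mul' (ENNReal.ofReal_le_ofReal e2) le_rfl)

end Atoms

section Whitney

/-- The centre of the dyadic cube of side `2 ^ k.1` with integer position `k.2`. -/
def dyadicCenter (k : ℤ × (Fin N → ℤ)) : RN N :=
  WithLp.toLp 2 fun i => (2 : ℝ) ^ k.1 * (k.2 i : ℝ)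

/-- The dyadic cube `k` is of Whitney type for the distance-like function `d`. -/
def IsWhitney (d : RN N → ℝ) (k : ℤ × (Fin N → ℤ)) : Prop :=
  8 * (N : ℝ) ^ 2 * 2 ^ k.1 ≤ d (dyadicCenter k) ∧ d (dyadicCenter k) ≤ 19 * (N : ℝ) ^ 2 * 2 ^ k.1

variable {d : RN N → ℝ}

lemma exists_isWhitney (hN : 1 ≤ N) (hd : ∀ x y, d x ≤ d y + dist x y) {x : RN N} (hx : 0 < d x) :
    ∃ k, IsWhitney d k ∧ dist x (dyadicCenter k) < N * 2 ^ k.1 := by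
  have hN' : (1 : ℝ) ≤ N := by exact_mod_cast hN
  have hNN : (N : ℝ) ≤ (N : ℝ) ^ 2 := by nlinarith
  have hA : (0 : ℝ) < 8 * (N : ℝ) ^ 2 + N := by positivity
  obtain ⟨j, hj1, hj2⟩ := exists_mem_Ico_zpow (x := d x / (8 * (N : ℝ) ^ 2 + N)) (y := 2)
    (by positivity) one_lt_two
  have hs : (0 : ℝ) < 2 ^ j := by positivity
  rw [zpow_add_one₀ two_ne_zero, div_lt_iff₀ hA] at hj2
  rw [le_div_iff₀ hA] at hj1
  let k : ℤ × (Fin N → ℤ) := (j, fun i => round (x i / 2 ^ j))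
  have hdist : dist x (dyadicCenter k) ≤ N * (2 ^ j / 2) := by
    refine dist_le_of_mem_cube hs.le fun i => ?_
    have h1 := abs_sub_round (x i / 2 ^ j)
    have h2 : x i - dyadicCenter k i = 2 ^ j * (x i / 2 ^ j - round (x i / 2 ^ j)) := by
      simp only [dyadicCenter, k]
      field_simp
    rw [h2, abs_mul, abs_of_pos hs]
    nlinarith
  have h1 := hd x (dyadicCenter k)
  have h2 := hd (dyadicCenter k) x
  rw [dist_comm] at h2
  have h3 : (N : ℝ) * 2 ^ j ≤ (N : ℝ) ^ 2 * 2 ^ j := by gcongr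
  have h4 : (0 : ℝ) < N * 2 ^ j := by positivity
  refine ⟨k, ⟨?_, ?_⟩, ?_⟩ <;> simp only [k] at * <;> nlinarith

lemma IsWhitney.bounds (hN : 1 ≤ N) (hd : ∀ x y, d x ≤ d y + dist x y) {k : ℤ × (Fin N → ℤ)}
    (hk : IsWhitney d k) {y : RN N} (hy : y ∈ cube (dyadicCenter k) (4 * (2 * N * 2 ^ k.1))) :
    4 * (N : ℝ) ^ 2 * 2 ^ k.1 ≤ d y ∧ d y ≤ 23 * (N : ℝ) ^ 2 * 2 ^ k.1 := by
  have h := dist_le_of_mem_cube (by positivity) hy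
  have h1 := hd y (dyadicCenter k)
  have h2 := hd (dyadicCenter k) y
  rw [dist_comm] at h2
  obtain ⟨h3, h4⟩ := hk
  constructor <;> nlinarith

lemma IsWhitney.scale_le (hN : 1 ≤ N) (hd : ∀ x y, d x ≤ d y + dist x y)
    {k l : ℤ × (Fin N → ℤ)} (hk : IsWhitney d k) (hl : IsWhitney d l) {y : RN N}
    (hyk : y ∈ cube (dyadicCenter k) (4 * (2 * N * 2 ^ k.1)))
    (hyl : y ∈ cube (dyadicCenter l) (4 * (2 * N * 2 ^ l.1))) :
    (2 : ℝ) ^ k.1 ≤ 6 * 2 ^ l.1 := by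
  have hN' : (0 : ℝ) < (N : ℝ) ^ 2 := by positivity
  have h1 := (hk.bounds hN hd hyk).1
  have h2 := (hl.bounds hN hd hyl).2
  have h3 : (N : ℝ) ^ 2 * (4 * 2 ^ k.1) ≤ (N : ℝ) ^ 2 * (23 * 2 ^ l.1) := by linarith
  have h4 := le_of_mul_le_mul_left h3 hN'
  have : (0 : ℝ) < 2 ^ l.1 := by positivity
  linarith

/-- Bounded overlap of Whitney cubes. -/
lemma card_le_of_isWhitney (hN : 1 ≤ N) (hd : ∀ x y, d x ≤ d y + dist x y) {ι : Type*}
    {S : Finset ι} {idx : ι → ℤ × (Fin N → ℤ)} (hidx : Set.InjOn idx S) (y : RN N)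
    (hS : ∀ k ∈ S, IsWhitney d (idx k) ∧
      y ∈ cube (dyadicCenter (idx k)) (4 * (2 * N * 2 ^ (idx k).1))) :
    S.card ≤ 3 * (8 * N + 1) ^ N := by
  have hN2 : (0 : ℝ) < (N : ℝ) ^ 2 := by positivity
  rcases S.eq_empty_or_nonempty with rfl | ⟨k₀, hk₀⟩
  · simp
  have hy0 : 0 < d y := lt_of_lt_of_le (by positivity) ((hS k₀ hk₀).1.bounds hN hd (hS k₀ hk₀).2).1
  obtain ⟨j₀, hj1, hj2⟩ := exists_mem_Ico_zpow (x := d y / (4 * (N : ℝ) ^ 2)) (y := 2)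
    (by positivity) one_lt_two
  rw [le_div_iff₀ (by positivity)] at hj1
  rw [div_lt_iff₀ (by positivity)] at hj2
  let Ψ : ι → ℤ × (Fin N → ℤ) := fun k => (j₀ - (idx k).1,
    fun i => (idx k).2 i - ⌈y i / 2 ^ (idx k).1 - 4 * N⌉)
  have hmaps : ∀ k ∈ S, Ψ k ∈ (Finset.Icc (0 : ℤ) 2) ×ˢ
      (Fintype.piFinset fun _ : Fin N => Finset.Icc (0 : ℤ) (8 * N)) := by
    intro k hk
    obtain ⟨hw, hyk⟩ := hS k hk
    obtain ⟨h1, h2⟩ := hw.bounds hN hd hyk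
    have hs : (0 : ℝ) < 2 ^ (idx k).1 := by positivity
    have hs0 : (0 : ℝ) < 2 ^ j₀ := by positivity
    rw [Finset.mem_product, Fintype.mem_piFinset, Finset.mem_Icc]
    refine ⟨⟨?_, ?_⟩, fun i => ?_⟩
    · have : (2 : ℝ) ^ (idx k).1 < 2 ^ (j₀ + 1) := by
        have : (N : ℝ) ^ 2 * 2 ^ (idx k).1 < (N : ℝ) ^ 2 * 2 ^ (j₀ + 1) := by linarith
        exact lt_of_mul_lt_mul_left this hN2.le
      have := (zpow_lt_zpow_iff_right₀ one_lt_two).1 this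
      simp only [Ψ]; omega
    · have : (2 : ℝ) ^ j₀ < 2 ^ ((idx k).1 + 3) := by
        have h3 : (N : ℝ) ^ 2 * (4 * 2 ^ j₀) ≤ (N : ℝ) ^ 2 * (23 * 2 ^ (idx k).1) := by linarith
        have h4 := le_of_mul_le_mul_left h3 hN2
        rw [zpow_add₀ two_ne_zero]
        norm_num
        linarith
      have := (zpow_lt_zpow_iff_right₀ one_lt_two).1 this
      simp only [Ψ]; omega
    · have h5 := hyk i
      have h6 : y i - dyadicCenter (idx k) i =
          2 ^ (idx k).1 * (y i / 2 ^ (idx k).1 - (idx k).2 i) := by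
        simp only [dyadicCenter]
        field_simp
      rw [h6, abs_mul, abs_of_pos hs] at h5
      have h7 : |y i / 2 ^ (idx k).1 - (idx k).2 i| ≤ 4 * N := by
        refine le_of_mul_le_mul_left (h5.trans_eq ?_) hs
        ring
      rw [abs_le] at h7
      simp only [Ψ, Finset.mem_Icc, sub_nonneg, Int.ceil_le, tsub_le_iff_right]
      refine ⟨by linarith, ?_⟩
      have h8 := Int.le_ceil (y i / 2 ^ (idx k).1 - 4 * (N : ℝ))
      refine (Int.cast_le (R := ℝ)).1 ?_
      push_cast
      linarith
  have hinj : Set.InjOn Ψ S := by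
    intro k hk l hl hkl
    refine hidx hk hl ?_
    have h1 : (idx k).1 = (idx l).1 := by
      have := congrArg Prod.fst hkl
      simp only [Ψ] at this
      omega
    refine Prod.ext h1 (funext fun i => ?_)
    have := congrFun (congrArg Prod.snd hkl) i
    simp only [Ψ, h1] at this
    omega
  refine (Finset.card_le_card_of_injOn Ψ hmaps hinj).trans_eq ?_
  rw [Finset.card_product, Fintype.card_piFinset_const]
  simp
  norm_cast

end Whitney

section Partition

lemma ScaledBound.of_le_mul_scale {J : ℕ} {A c r r' : ℝ} {u : RN N → ℝ} {y : RN N}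
    (h : ScaledBound J A r u y) (hA : 0 ≤ A) (hc : 1 ≤ c) (hr : 0 ≤ r) (hr' : r ≤ c * r') :
    ScaledBound J (A * c ^ J) r' u y := by
  intro j hj
  have hr'' : 0 ≤ r' := by nlinarith
  calc _ ≤ A * r ^ j := h j hj
    _ ≤ A * (c * r') ^ j := by gcongr
    _ = A * c ^ j * r' ^ j := by rw [mul_pow]; ring
    _ ≤ _ := by gcongr

lemma scaledBound_const (J : ℕ) {r : ℝ} (hr : 0 ≤ r) (y : RN N) :
    ScaledBound J 1 r (fun _ => 1) y := by
  intro j _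
  rcases Nat.eq_zero_or_pos j with rfl | hj
  · simp
  · rw [iteratedFDeriv_const_of_ne hj.ne']
    simp only [Pi.zero_apply, norm_zero]
    positivity

open Classical in
lemma scaledBound_prod_one_sub {J : ℕ} {A r : ℝ} {χ : ℕ → RN N → ℝ} {y : RN N} (hA : 1 ≤ A)
    (hr : 0 ≤ r) (k : ℕ) (hχ : ∀ l < k, ContDiff ℝ (⊤ : ℕ∞) (χ l))
    (hb : ∀ l < k, y ∈ tsupport (χ l) → ScaledBound J A r (fun y => 1 - χ l y) y) :
    ScaledBound J ((2 ^ J * A) ^ ((Finset.range k).filter fun l => y ∈ tsupport (χ l)).card) r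
      (fun y => ∏ l ∈ Finset.range k, (1 - χ l y)) y := by
  induction k with
  | zero => simpa using scaledBound_const J hr y
  | succ k ih =>
    have ih := ih (fun l hl => hχ l (by omega)) (fun l hl => hb l (by omega))
    simp only [Finset.prod_range_succ]
    rw [Finset.range_add_one, Finset.filter_insert]
    split_ifs with hy
    · rw [Finset.card_insert_of_notMem (by simp), pow_succ]
      refine (ih.mul (hb k (by omega) hy) ?_ ?_ (by positivity) (by linarith) hr).mono
        (by positivity) (le_of_eq (by ring)) hr le_rfl
      · exact contDiff_prod fun l hl =>
          contDiff_const.sub (hχ l (by have := Finset.mem_range.1 hl; omega))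
      · exact contDiff_const.sub (hχ k (by omega))
    · refine scaledBound_of_eventuallyEq ?_ ih
      have : χ k =ᶠ[𝓝 y] 0 := notMem_tsupport_iff_eventuallyEq.1 hy
      filter_upwards [this] with z hz
      simp [hz]

/-- The partition functions `χ k * ∏ l < k, (1 - χ l)` built from cutoffs `χ`. -/
def partitionFun (χ : ℕ → RN N → ℝ) (k : ℕ) (y : RN N) : ℝ :=
  χ k y * ∏ l ∈ Finset.range k, (1 - χ l y)

lemma sum_partitionFun (χ : ℕ → RN N → ℝ) (M : ℕ) (y : RN N) :
    ∑ k ∈ Finset.range M, partitionFun χ k y = 1 - ∏ l ∈ Finset.range M, (1 - χ l y) := by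
  induction M with
  | zero => simp
  | succ M ih =>
    rw [Finset.sum_range_succ, ih, Finset.prod_range_succ, partitionFun]
    ring

/-- Smooth Whitney partitions over compact sets. -/
lemma exists_whitney_partition (hN : 1 ≤ N) (L : ℕ) : ∃ A, 0 < A ∧
    ∀ (d : RN N → ℝ), (∀ x y, d x ≤ d y + dist x y) → ∀ K : Set (RN N), IsCompact K →
      (∀ x ∈ K, 0 < d x) → ∃ (M : ℕ) (a : ℕ → RN N) (s : ℕ → ℝ) (η : ℕ → RN N → ℝ),
        (∀ k < M, 0 < s k ∧ AdaptedCutoff L A (2 * N) (a k) (s k) (η k) ∧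
          d (a k) < 20 * (N : ℝ) ^ 2 * s k ∧
          ∀ y ∈ cube (a k) (4 * (2 * N * s k)), 0 < d y) ∧
        (∀ y, 0 ≤ ∑ k ∈ Finset.range M, η k y ∧ ∑ k ∈ Finset.range M, η k y ≤ 1) ∧
        (∀ y ∈ K, ∑ k ∈ Finset.range M, η k y = 1) ∧
        ∀ y, {k | k < M ∧ y ∈ cube (a k) (4 * (2 * N * s k))}.ncard ≤ 3 * (8 * N + 1) ^ N := by
  have hN' : (1 : ℝ) ≤ N := by exact_mod_cast hN
  let χ₀ : ContDiffBump (0 : RN N) := ⟨N, 2 * N, by positivity, by linarith⟩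
  have hχ₀ : ContDiff ℝ (⊤ : ℕ∞) χ₀ := χ₀.contDiff
  obtain ⟨C, hC, hχb⟩ := exists_scaledBound_of_hasCompactSupport hχ₀ χ₀.hasCompactSupport L
  set A₁ : ℝ := 1 + C * 6 ^ L with hA₁
  have hA₁' : 1 ≤ A₁ := by
    have : 0 < C * 6 ^ L := by positivity
    linarith
  have h2A : 1 ≤ 2 ^ L * A₁ := by
    have : (1 : ℝ) ≤ 2 ^ L := one_le_pow₀ one_le_two
    nlinarith
  refine ⟨2 ^ L * C * (2 ^ L * A₁) ^ (3 * (8 * N + 1) ^ N), by positivity, ?_⟩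
  intro d hd K hK hKd
  let ι := {k : ℤ × (Fin N → ℤ) // IsWhitney d k}
  obtain ⟨t, ht⟩ := hK.elim_finite_subcover
    (fun k : ι => ball (dyadicCenter k.1) (N * 2 ^ k.1.1)) (fun _ => isOpen_ball) (fun x hx => by
      obtain ⟨k, hk, hxk⟩ := exists_isWhitney hN hd (hKd x hx)
      exact mem_iUnion.2 ⟨⟨k, hk⟩, hxk⟩)
  let idx : ℕ → ℤ × (Fin N → ℤ) := fun l =>
    if h : l < t.card then (t.equivFin.symm ⟨l, h⟩).1.1 else 0
  have hidx : ∀ l (h : l < t.card), idx l = (t.equivFin.symm ⟨l, h⟩).1.1 := fun l h => dif_pos h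
  have hw : ∀ l < t.card, IsWhitney d (idx l) := fun l h => by
    rw [hidx l h]
    exact (t.equivFin.symm ⟨l, h⟩).1.2
  have hinj : Set.InjOn idx (Finset.range t.card) := by
    intro k hk l hl hkl
    have hk := Finset.mem_range.1 hk
    have hl := Finset.mem_range.1 hl
    rw [hidx k hk, hidx l hl] at hkl
    have := t.equivFin.symm.injective (Subtype.ext (Subtype.ext hkl))
    simpa using this
  have hcov : ∀ x ∈ K, ∃ l < t.card, dist x (dyadicCenter (idx l)) < N * 2 ^ (idx l).1 := by
    intro x hx
    obtain ⟨k, hk, hxk⟩ := mem_iUnion₂.1 (ht hx)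
    refine ⟨t.equivFin ⟨k, hk⟩, (t.equivFin ⟨k, hk⟩).2, ?_⟩
    rw [hidx _ (t.equivFin ⟨k, hk⟩).2]
    simpa using hxk
  let s : ℕ → ℝ := fun l => 2 ^ (idx l).1
  let a : ℕ → RN N := fun l => dyadicCenter (idx l)
  have hs : ∀ l, 0 < s l := fun l => by positivity
  let χ : ℕ → RN N → ℝ := fun l y => χ₀ ((s l)⁻¹ • (y - a l))
  have hχ : ∀ l, ContDiff ℝ (⊤ : ℕ∞) (χ l) := fun l => by
    have := hχ₀
    simp only [χ]
    fun_prop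
  have hχbd : ∀ l y, ScaledBound L C (s l)⁻¹ (χ l) y := fun l y => by
    have := ScaledBound.comp_smul_sub (a := a l) (y := y) hχ₀ (hχb ((s l)⁻¹ • (y - a l)))
    rwa [abs_of_pos (inv_pos.2 (hs l))] at this
  have hχs : ∀ l, tsupport (χ l) ⊆ closedBall (a l) (2 * N * s l) := fun l => by
    refine closure_minimal (fun y hy => ?_) isClosed_closedBall
    have : (s l)⁻¹ • (y - a l) ∈ Function.support χ₀ := hy
    rw [χ₀.support_eq, mem_ball_zero_iff, norm_smul, norm_inv, Real.norm_of_nonneg (hs l).le,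
      inv_mul_lt_iff₀ (hs l), ← dist_eq_norm] at this
    rw [mem_closedBall, mul_comm]
    exact this.le
  have hχcube : ∀ l, ∀ y ∈ tsupport (χ l), y ∈ cube (a l) (4 * (2 * N * s l)) := fun l y hy =>
    mem_cube_of_dist_le (by
      have := mem_closedBall.1 (hχs l hy)
      have h0 : 0 < 2 * N * s l := by have := hs l; positivity
      linarith)
  have hprod : ∀ M y, 0 ≤ ∏ l ∈ Finset.range M, (1 - χ l y) ∧
      ∏ l ∈ Finset.range M, (1 - χ l y) ≤ 1 := fun M y =>
    ⟨Finset.prod_nonneg fun l _ => sub_nonneg.2 χ₀.le_one,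
      Finset.prod_le_one (fun l _ => sub_nonneg.2 χ₀.le_one)
        fun l _ => sub_le_self _ χ₀.nonneg⟩
  refine ⟨t.card, a, s, partitionFun χ, fun k hk => ⟨hs k, ⟨?_, ?_, fun y => ?_⟩, ?_, fun y hy => ?_⟩,
    fun y => ?_, fun y hy => ?_, fun y => ?_⟩
  · exact (hχ k).mul (contDiff_prod fun l _ => contDiff_const.sub (hχ l))
  · exact tsupport_mul_subset_left.trans (hχs k)
  · by_cases hy : y ∈ tsupport (χ k)
    · classical
      have hb : ∀ l < k, y ∈ tsupport (χ l) →
          ScaledBound L A₁ (s k)⁻¹ (fun y => 1 - χ l y) y := fun l hl hyl => by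
        have hkl := (hw k hk).scale_le hN hd (hw l (hl.trans hk)) (hχcube k y hy) (hχcube l y hyl)
        refine (scaledBound_const L (inv_pos.2 (hs k)).le y).sub
          ((hχbd l y).of_le_mul_scale hC.le (by norm_num) (inv_pos.2 (hs l)).le ?_)
          contDiff_const (hχ l)
        rw [← div_eq_mul_inv, le_div_iff₀ (hs k), inv_mul_le_iff₀ (hs l), mul_comm]
        exact hkl
      have hcard : ((Finset.range k).filter fun l => y ∈ tsupport (χ l)).card ≤
          3 * (8 * N + 1) ^ N := by
        refine card_le_of_isWhitney hN hd (idx := idx) (hinj.mono fun l hl => ?_) y fun l hl => ?_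
        · simp only [Finset.coe_filter, Finset.mem_range, Set.mem_ofPred_eq] at hl
          simpa using hl.1.trans hk
        · simp only [Finset.mem_filter, Finset.mem_range] at hl
          exact ⟨hw l (hl.1.trans hk), hχcube l y hl.2⟩
      have hpos : 0 ≤ (s k)⁻¹ := (inv_pos.2 (hs k)).le
      refine ((hχbd k y).mul (scaledBound_prod_one_sub hA₁' hpos k (fun l _ => hχ l) hb) (hχ k)
        (contDiff_prod fun l _ => contDiff_const.sub (hχ l)) hC.le (by positivity) hpos).mono
        (by positivity) ?_ hpos le_rfl
      gcongr
    · exact scaledBound_of_notMem_tsupport (fun h => hy (tsupport_mul_subset_left h))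
        (by positivity) (inv_pos.2 (hs k)).le
  · refine (hw k hk).2.trans_lt ?_
    have : 0 < (N : ℝ) ^ 2 * s k := by have := hs k; positivity
    simp only [s] at this ⊢
    linarith
  · exact lt_of_lt_of_le (by positivity) ((hw k hk).bounds hN hd hy).1
  · rw [sum_partitionFun]
    exact ⟨by linarith [(hprod t.card y).2], by linarith [(hprod t.card y).1]⟩
  · obtain ⟨l, hl, hyl⟩ := hcov y hy
    rw [sum_partitionFun, Finset.prod_eq_zero (Finset.mem_range.2 hl), sub_zero]
    have : χ l y = 1 := by
      refine χ₀.one_of_mem_closedBall ?_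
      rw [mem_closedBall_zero_iff, norm_smul, norm_inv, Real.norm_of_nonneg (hs l).le,
        inv_mul_le_iff₀ (hs l), ← dist_eq_norm, mul_comm]
      exact hyl.le
    rw [this, sub_self]
  · classical
    have : {k | k < t.card ∧ y ∈ cube (a k) (4 * (2 * N * s k))} =
        ((Finset.range t.card).filter fun k => y ∈ cube (a k) (4 * (2 * N * s k)) : Finset ℕ) := by
      ext k; simp
    rw [this, Set.ncard_coe_finset]
    refine card_le_of_isWhitney hN hd (idx := idx) (hinj.mono fun l hl => ?_) y fun l hl => ?_
    · simp only [Finset.coe_filter, Finset.mem_range, Set.mem_ofPred_eq] at hl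
      simpa using hl.1
    · simp only [Finset.mem_filter, Finset.mem_range] at hl
      exact ⟨hw l hl.1, hl.2⟩

end Partition

section GrandMax

variable {E : Type*} [NormedAddCommGroup E] [NormedSpace ℝ E]

lemma foldr_comp_apply_of_fixed {X : Type*} (l : List (X → X)) {x : X} (h : ∀ g ∈ l, g x = x) :
    l.foldr (· ∘ ·) id x = x := by
  induction l with
  | nil => rfl
  | cons g l ih =>
    rw [List.foldr_cons, Function.comp_apply, ih fun g' hg' => h g' (List.mem_cons_of_mem _ hg')]
    exact h g List.mem_cons_self

lemma md_zero_index (u : RN N → E) : md (0 : Fin N → ℕ) u = u :=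
  foldr_comp_apply_of_fixed _ fun g hg => by
    obtain ⟨i, rfl⟩ := (List.mem_ofFn' _ _).1 hg
    rfl

lemma md_zero (α : Fin N → ℕ) : md α (0 : RN N → E) = 0 :=
  foldr_comp_apply_of_fixed _ fun g hg => by
    obtain ⟨i, rfl⟩ := (List.mem_ofFn' _ _).1 hg
    refine Function.iterate_fixed ?_ _
    ext x
    simp [pd]

lemma hzNorm_zero (γ : ℝ) : hzNorm γ (0 : RN N → ℂ) = 0 := by
  simp [hzNorm, hzSemi, md_zero]

lemma bmoNorm_zero : bmoNorm (0 : RN N → ℂ) = 0 := by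
  simp [bmoNorm]

lemma exists_grandMax_le (hN : 1 ≤ N) (L : ℕ) {f : RN N → ℂ} (hf : Continuous f)
    (hfc : HasCompactSupport f) {α : ℝ} (hα : 0 < α) :
    ∃ x, grandMax L f x ≤ ENNReal.ofReal α := by
  obtain ⟨r, hr⟩ := hfc.isCompact.isBounded.subset_closedBall 0
  have hint : Integrable f := hf.integrable_of_hasCompactSupport hfc
  set I := ∫ z, ‖f z‖ with hI
  have hI0 : 0 ≤ I := integral_nonneg fun _ => norm_nonneg _
  set D := max 1 (I / α) with hD
  have hD1 : 1 ≤ D := le_max_left _ _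
  refine ⟨EuclideanSpace.single ⟨0, hN⟩ (D + |r|), ?_⟩
  set x : RN N := EuclideanSpace.single ⟨0, hN⟩ (D + |r|) with hx
  have hxn : ‖x‖ = D + |r| := by
    rw [hx, PiLp.norm_single, Real.norm_of_nonneg (by positivity)]
  refine iSup₂_le fun t ht => iSup₂_le fun ψ hψ => ENNReal.ofReal_le_ofReal ?_
  obtain ⟨-, -, hψs, hψb⟩ := hψ
  rcases le_or_gt t D with htD | htD
  · have : ∀ z, ψ z • f z = 0 := fun z => by
      by_contra h
      have h1 := hψs (subset_tsupport _ (left_ne_zero_of_smul h))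
      have h2 := hr (subset_tsupport _ (right_ne_zero_of_smul h))
      rw [mem_ball, dist_comm] at h1
      rw [mem_closedBall] at h2
      have := dist_triangle x z 0
      rw [dist_zero_right x, hxn] at this
      linarith [le_abs_self r]
    simpa [this] using hα.le
  · have h1 : ∀ z, ‖ψ z • f z‖ ≤ (D ^ N)⁻¹ * ‖f z‖ := fun z => by
      rw [norm_smul]
      gcongr
      have := hψb 0 (by simp [mOrder]) z
      rw [md_zero_index] at this
      refine this.trans ?_
      simp only [mOrder, Pi.zero_apply, Finset.sum_const_zero, add_zero]
      gcongr
    refine (norm_integral_le_of_norm_le (hint.norm.const_mul _) (ae_of_all _ h1)).trans ?_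
    rw [integral_const_mul, inv_mul_le_iff₀ (by positivity)]
    have h2 : I / α ≤ D ^ N := (le_max_right _ _).trans (le_self_pow₀ hD1 (by omega))
    rwa [div_le_iff₀ hα] at h2

lemma integral_dil_sub {φ : RN N → ℝ} (hφ : GoodPhi φ) {t : ℝ} (ht : 0 < t) (x : RN N) :
    ∫ y, dil φ t (x - y) = 1 := by
  rw [integral_sub_left_eq_self (fun y => dil φ t y)]
  simp only [dil]
  rw [integral_div, Measure.integral_comp_inv_smul, hφ.int_one]
  simp [abs_of_pos ht, ht.ne']

/-- A continuous function is dominated by its grand maximal function. -/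
lemma exists_norm_le_grandMax {φ : RN N → ℝ} (hφ : GoodPhi φ) (L : ℕ) : ∃ C, 0 < C ∧
    ∀ f : RN N → ℂ, Continuous f → HasCompactSupport f → ∀ x,
      ENNReal.ofReal ‖f x‖ ≤ ENNReal.ofReal C * grandMax L f x := by
  obtain ⟨C, hC, hdil⟩ := exists_dil_bound hφ L
  refine ⟨C * 2 ^ (N + L), by positivity, fun f hf hfc x => ?_⟩
  refine ENNReal.le_of_forall_pos_le_add fun ε hε _ => ?_
  obtain ⟨δ, hδ, hfδ⟩ := Metric.continuous_iff.1 hf x ε hε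
  obtain ⟨hΦ, hΦs, hΦb⟩ := hdil (δ / 2) (by positivity) x
  have hδ2 : 0 < δ / 2 := by positivity
  have hcs : HasCompactSupport (fun y => dil φ (δ / 2) (x - y)) :=
    HasCompactSupport.of_support_subset_isCompact (isCompact_closedBall x (δ / 2))
      ((subset_tsupport _).trans hΦs)
  have hΦi : Integrable (fun y => dil φ (δ / 2) (x - y)) :=
    hΦ.continuous.integrable_of_hasCompactSupport hcs
  have h1 : ENNReal.ofReal ‖∫ y, dil φ (δ / 2) (x - y) • f y‖ ≤
      ENNReal.ofReal (C * 2 ^ (N + L)) * grandMax L f x := by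
    refine le_grandMax hΦ hC one_le_two hδ2
      (hΦs.trans (closedBall_subset_ball (by linarith))) fun j hj z => ?_
    refine (hΦb z j hj).trans_eq ?_
    rw [pow_add, inv_pow]
    field_simp
  have h2 : ‖(∫ y, dil φ (δ / 2) (x - y) • f y) - f x‖ ≤ ε := by
    have h3 : (∫ y, dil φ (δ / 2) (x - y) • f y) - f x =
        ∫ y, dil φ (δ / 2) (x - y) • (f y - f x) := by
      simp only [smul_sub]
      rw [integral_sub, integral_smul_const, integral_dil_sub hφ hδ2, one_smul]
      · exact (hΦ.continuous.smul hf).integrable_of_hasCompactSupport hfc.smul_left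
      · exact hΦi.smul_const _
    rw [h3]
    have hnn : ∀ y, 0 ≤ dil φ (δ / 2) (x - y) := fun y => div_nonneg (hφ.nonneg _) (by positivity)
    refine (norm_integral_le_of_norm_le (hΦi.mul_const (ε : ℝ)) (ae_of_all _ fun y => ?_)).trans_eq ?_
    · rw [norm_smul, Real.norm_of_nonneg (hnn y)]
      by_cases hy : dil φ (δ / 2) (x - y) = 0
      · simp [hy]
      · have := hΦs (subset_tsupport _ hy)
        rw [mem_closedBall] at this
        have := hfδ y (by linarith)
        rw [dist_eq_norm] at this
        exact mul_le_mul_of_nonneg_left this.le (hnn y)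
    · rw [integral_mul_const, integral_dil_sub hφ hδ2, one_mul]
  calc ENNReal.ofReal ‖f x‖ ≤
        ENNReal.ofReal (‖∫ y, dil φ (δ / 2) (x - y) • f y‖ + (ε : ℝ)) := by
        refine ENNReal.ofReal_le_ofReal ?_
        have := norm_sub_norm_le (f x) (∫ y, dil φ (δ / 2) (x - y) • f y)
        rw [norm_sub_rev] at this
        linarith
    _ ≤ _ := by
        rw [ENNReal.ofReal_add (norm_nonneg _) ε.coe_nonneg, ENNReal.ofReal_coe_nnreal]
        gcongr

end GrandMax

section Assembly

lemma ofReal_pow_mul_le_setLIntegral {G : RN N → ℝ≥0∞} {a x' : RN N} {s α p : ℝ} {Q : Set (RN N)}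
    (hs : 0 ≤ s) (hp : 0 ≤ p) (hQm : MeasurableSet Q) (hQ : closedBall a s ⊆ Q)
    (hG : ∀ y ∈ Q, ENNReal.ofReal α < G y) (hx : G x' ≤ ENNReal.ofReal α) :
    ENNReal.ofReal (s ^ N) * G x' ^ p ≤
      ENNReal.ofReal (ballVol N)⁻¹ * ∫⁻ x in Q, G x ^ p := by
  have hv : 0 < ballVol N :=
    ENNReal.toReal_pos (measure_ball_pos _ _ one_pos).ne' measure_ball_lt_top.ne
  have h1 : ENNReal.ofReal α ^ p * volume Q ≤ ∫⁻ x in Q, G x ^ p := by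
    rw [← setLIntegral_const]
    exact setLIntegral_mono' hQm fun x hx => ENNReal.rpow_le_rpow (hG x hx).le hp
  have h2 : ENNReal.ofReal (s ^ N) * ENNReal.ofReal (ballVol N) ≤ volume Q := by
    refine le_trans (le_of_eq ?_) (measure_mono hQ)
    rw [Measure.addHaar_closedBall _ _ hs, finrank_euclideanSpace_fin,
      ofReal_measureReal measure_ball_lt_top.ne]
  calc ENNReal.ofReal (s ^ N) * G x' ^ p
      ≤ ENNReal.ofReal (s ^ N) * ENNReal.ofReal α ^ p := by gcongr
    _ = ENNReal.ofReal (ballVol N)⁻¹ *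
        (ENNReal.ofReal α ^ p * (ENNReal.ofReal (s ^ N) * ENNReal.ofReal (ballVol N))) := by
      rw [mul_comm (ENNReal.ofReal (s ^ N)) (ENNReal.ofReal (ballVol N)), mul_left_comm,
        ← mul_assoc (ENNReal.ofReal (ballVol N)⁻¹), ← ENNReal.ofReal_mul (by positivity),
        inv_mul_cancel₀ hv.ne', ENNReal.ofReal_one, one_mul, mul_comm]
    _ ≤ _ := by gcongr; exact (mul_le_mul_right h2 _).trans h1

lemma norm_sum_le_of_ncard {ι E : Type*} [SeminormedAddCommGroup E] {s : Finset ι} {h : ι → E}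
    {S : ι → Prop} {n : ℕ} {b : ℝ} (hb : 0 ≤ b) (hS : ∀ k ∈ s, ¬ S k → h k = 0)
    (hh : ∀ k ∈ s, ‖h k‖ ≤ b) (hn : {k | k ∈ s ∧ S k}.ncard ≤ n) :
    ‖∑ k ∈ s, h k‖ ≤ n * b := by
  classical
  rw [← Finset.sum_filter_of_ne (p := S) fun k hk h0 => not_not.1 fun hSk => h0 (hS k hk hSk)]
  refine (norm_sum_le_of_le _ fun k hk => hh k (Finset.mem_filter.1 hk).1).trans ?_
  rw [Finset.sum_const, nsmul_eq_mul]
  gcongr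
  refine le_trans (le_of_eq ?_) hn
  rw [← Set.ncard_coe_finset]
  congr 1
  ext k
  simp

end Assembly

/-- Finite Calderón–Zygmund decomposition with small remainder (Corollary 4.1). -/
theorem statement8 {N m : ℕ} (hN : 1 ≤ N) (hm : 1 ≤ m) (p : ℝ)
    (hp₁ : (N : ℝ) / (N + m) < p) (hp₂ : p ≤ 1)
    (L : ℕ) (hL : (N : ℝ) * (1 / p - 1) < L)
    (φ₀ : RN N → ℝ) (hφ₀ : GoodPhi φ₀) :
    ∃ c : ℝ, 0 < c ∧
      ∀ f : RN N → ℂ, ContDiff ℝ (⊤ : ℕ∞) f → HasCompactSupport f →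
      ∀ α : ℝ, 0 < α → ∀ ε : ℝ, 0 < ε →
        ∃ (M : ℕ) (g ρ : RN N → ℂ) (β : ℕ → RN N → ℂ) (ctr : ℕ → RN N) (len : ℕ → ℝ),
          Measurable g ∧ (∀ᵐ x : RN N, ‖g x‖ ≤ c * α) ∧
          (∀ k < M, 0 < len k ∧
            ContDiff ℝ (m : ℕ∞) (β k) ∧
            tsupport (β k) ⊆ cube (ctr k) (len k) ∧
            cube (ctr k) (len k) ⊆ {x | ENNReal.ofReal α < grandMax L f x} ∧
            (∀ γ : Fin N → ℕ, mOrder γ ≤ m - 1 →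
              ∫ x : RN N, (∏ i, ((x i : ℝ) : ℂ) ^ γ i) * β k x = 0) ∧
            (∫⁻ x, (⨆ (t : ℝ) (_ : 0 < t), ENNReal.ofReal ‖convAt φ₀ t (β k) x‖) ^ p) ≤
              ENNReal.ofReal c * ∫⁻ x in cube (ctr k) (len k), grandMax L f x ^ p) ∧
          (∀ x : RN N, (({k | k < M ∧ x ∈ cube (ctr k) (len k)}.ncard : ℕ) : ℝ) ≤ c) ∧
          (∀ x : RN N, f x = g x + (∑ k ∈ Finset.range M, β k x) + ρ x) ∧
          (p < 1 → hzNorm ((N : ℝ) * (1 / p - 1)) ρ ≤ ε) ∧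
          (p = 1 → bmoNorm ρ ≤ ENNReal.ofReal ε) := by
  have hN' : (1 : ℝ) ≤ N := by exact_mod_cast hN
  have hm' : (1 : ℝ) ≤ m := by exact_mod_cast hm
  have hp : 0 < p := lt_trans (by positivity) hp₁
  have hpN : (N : ℝ) < (N + m) * p := by
    rwa [div_lt_iff₀ (by positivity), mul_comm] at hp₁
  obtain ⟨A, hA, hpart⟩ := exists_whitney_partition hN L
  obtain ⟨B, hB, hatoms⟩ := exists_atoms hφ₀ m L (K := 20 * (N : ℝ) ^ 2)
    (R := 2 * N) (by linarith) hA (by positivity) hp hpN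
  obtain ⟨C₁, hC₁, hfG⟩ := exists_norm_le_grandMax hφ₀ L
  have hv : 0 ≤ (ballVol N)⁻¹ := by positivity
  set n : ℕ := 3 * (8 * N + 1) ^ N with hn
  refine ⟨n * B + (C₁ + 1) + n + B * (1 + (ballVol N)⁻¹), by positivity,
    fun f hf hfc α hα ε hε => ?_⟩
  set c := n * B + (C₁ + 1) + n + B * (1 + (ballVol N)⁻¹) with hc
  have hnB : 0 ≤ n * B := by positivity
  have hBv : 0 ≤ B * (1 + (ballVol N)⁻¹) := by positivity
  have hn0 : (0 : ℝ) ≤ n := by positivity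
  set F : Set (RN N) := {x | grandMax L f x ≤ ENNReal.ofReal α} with hF
  have hFne : F.Nonempty := exists_grandMax_le hN L hf.continuous hfc hα
  have hdF : ∀ y, 0 < infDist y F → ENNReal.ofReal α < grandMax L f y := fun y hy => by
    by_contra! h
    exact hy.ne' (infDist_zero_of_mem (s := F) h)
  obtain ⟨δ, hδ, hfδ⟩ := Metric.uniformContinuous_iff.1
    (hfc.uniformContinuous_of_continuous hf.continuous) α hα
  obtain ⟨M, a, s, η, hatom, hη, hηK, hcard⟩ := hpart (fun x => infDist x F)
    (fun x y => infDist_le_infDist_add_dist) (tsupport f ∩ {y | δ / 2 ≤ infDist y F})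
    (hfc.isCompact.inter_right (isClosed_le continuous_const (continuous_infDist_pt F)))
    fun x hx => lt_of_lt_of_le (by positivity) hx.2
  have key : ∀ k, ∃ (β h : RN N → ℂ), k < M → ∃ x' ∈ F,
      (∀ y, η k y • f y = β y + h y) ∧ ContDiff ℝ (⊤ : ℕ∞) β ∧ Continuous h ∧
        tsupport β ⊆ closedBall (a k) (2 * N * s k) ∧
        (∀ y ∉ closedBall (a k) (2 * N * s k), h y = 0) ∧
        (∀ y, ENNReal.ofReal ‖h y‖ ≤ ENNReal.ofReal B * grandMax L f x') ∧
        (∀ P : RN N → ℝ, PolyLT m P → ∫ y, P y • β y = 0) ∧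
        ∫⁻ x, (⨆ (t : ℝ) (_ : 0 < t), ENNReal.ofReal ‖convAt φ₀ t β x‖) ^ p ≤
          ENNReal.ofReal B * ((∫⁻ x in cube (a k) (4 * (2 * N * s k)), grandMax L f x ^ p) +
            ENNReal.ofReal (s k ^ N) * grandMax L f x' ^ p) := fun k => by
    by_cases hk : k < M
    · obtain ⟨hs, hηk, hd, -⟩ := hatom k hk
      obtain ⟨x', hx', hdx⟩ := (infDist_lt_iff hFne).1 hd
      obtain ⟨β, h, hβ⟩ := hatoms (a k) (s k) (η k) f x' hs hηk hf hfc
        (by rw [dist_comm]; exact hdx.le)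
      exact ⟨β, h, fun _ => ⟨x', hx', hβ⟩⟩
    · exact ⟨0, 0, fun h => absurd h hk⟩
  choose β h hβ using key
  have hball : ∀ k < M, closedBall (a k) (2 * N * s k) ⊆ cube (a k) (4 * (2 * N * s k)) :=
    fun k hk y hy => mem_cube_of_dist_le (by
      have : 0 ≤ 2 * N * s k := by have := (hatom k hk).1; positivity
      rw [mem_closedBall] at hy
      linarith)
  have hbc : n * B * α + (C₁ + 1) * α ≤ c * α := by
    rw [← add_mul]
    exact mul_le_mul_of_nonneg_right (by linarith) hα.le
  have hg : ∀ y, f y - ∑ k ∈ Finset.range M, β k y =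
      (∑ k ∈ Finset.range M, h k y) + (1 - ∑ k ∈ Finset.range M, η k y) • f y := fun y => by
    have h1 : ∑ k ∈ Finset.range M, (η k y • f y) = ∑ k ∈ Finset.range M, (β k y + h k y) :=
      Finset.sum_congr rfl fun k hk =>
        let ⟨_, _, h2, _⟩ := hβ k (Finset.mem_range.1 hk)
        h2 y
    rw [sub_smul, one_smul, Finset.sum_smul, h1, Finset.sum_add_distrib]
    abel
  refine ⟨M, fun y => f y - ∑ k ∈ Finset.range M, β k y, 0, β, a,
    fun k => 4 * (2 * N * s k), ?_, ae_of_all _ fun y => ?_, fun k hk => ?_, fun y => ?_,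
    fun y => by simp, fun _ => (hzNorm_zero _).trans_le hε.le, fun _ => by simp [bmoNorm_zero]⟩
  · refine (hf.continuous.sub (continuous_finsetSum _ fun k hk => ?_)).measurable
    obtain ⟨x', -, -, hβs, -⟩ := hβ k (Finset.mem_range.1 hk)
    exact hβs.continuous
  · dsimp only
    rw [hg]
    refine (norm_add_le _ _).trans (le_trans (add_le_add ?_ ?_) hbc)
    · rw [mul_assoc]
      refine norm_sum_le_of_ncard (S := fun k => y ∈ cube (a k) (4 * (2 * N * s k)))
        (by positivity) (fun k hk hy => ?_) (fun k hk => ?_)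
        (by simpa only [Finset.mem_range] using hcard y)
      · obtain ⟨x', -, -, -, -, -, h0, -⟩ := hβ k (Finset.mem_range.1 hk)
        exact h0 y fun hy' => hy (hball k (Finset.mem_range.1 hk) hy')
      · obtain ⟨x', hx', -, -, -, -, -, hb, -⟩ := hβ k (Finset.mem_range.1 hk)
        rw [← ENNReal.ofReal_le_ofReal_iff (by positivity), ENNReal.ofReal_mul hB.le]
        exact (hb y).trans (mul_le_mul_right hx' _)
    · by_cases hyf : y ∈ tsupport f
      swap
      · rw [image_eq_zero_of_notMem_tsupport hyf, smul_zero, norm_zero]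
        positivity
      by_cases hyd : δ / 2 ≤ infDist y F
      · rw [hηK y ⟨hyf, hyd⟩, sub_self, zero_smul, norm_zero]
        positivity
      obtain ⟨x', hx', hdx⟩ := (infDist_lt_iff hFne).1 (not_le.1 hyd)
      have h1 : ‖f x'‖ ≤ C₁ * α := by
        rw [← ENNReal.ofReal_le_ofReal_iff (by positivity), ENNReal.ofReal_mul hC₁.le]
        exact (hfG f hf.continuous hfc x').trans (mul_le_mul_right hx' _)
      have h2 : ‖f y‖ ≤ (C₁ + 1) * α := by
        have h3 := hfδ (show dist y x' < δ by linarith)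
        rw [dist_eq_norm] at h3
        have h4 := norm_sub_norm_le (f y) (f x')
        linarith
      rw [norm_smul, Real.norm_of_nonneg (by linarith [(hη y).2])]
      exact (mul_le_of_le_one_left (norm_nonneg _) (by linarith [(hη y).1])).trans h2
  · obtain ⟨hs, -, -, hpos⟩ := hatom k hk
    obtain ⟨x', hx', -, hβs, -, hts, -, -, hmom, hint⟩ := hβ k hk
    have hsub := fun y hy => hdF y (hpos y hy)
    refine ⟨by positivity, hβs.of_le (by exact_mod_cast le_top), hts.trans (hball k hk), hsub,
      fun γ hγ => ?_, hint.trans ?_⟩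
    · rw [← hmom _ ((PolyLT.monomial γ).mono (by omega))]
      congr 1
      ext y
      simp
    · have hsR : s k ≤ 2 * N * s k := le_mul_of_one_le_left hs.le (by linarith)
      have h1 := ofReal_pow_mul_le_setLIntegral (G := grandMax L f) hs.le hp.le
        (isClosed_cube (a k) (4 * (2 * N * s k))).measurableSet
        ((closedBall_subset_closedBall hsR).trans (hball k hk)) hsub hx'
      calc _ ≤ ENNReal.ofReal B * ((1 + ENNReal.ofReal (ballVol N)⁻¹) *
            ∫⁻ x in cube (a k) (4 * (2 * N * s k)), grandMax L f x ^ p) := by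
            rw [add_mul, one_mul]
            gcongr
        _ ≤ _ := by
            rw [← mul_assoc, ← ENNReal.ofReal_one, ← ENNReal.ofReal_add zero_le_one hv,
              ← ENNReal.ofReal_mul hB.le]
            gcongr
            linarith
  · have : (({k | k < M ∧ y ∈ cube (a k) (4 * (2 * N * s k))}.ncard : ℕ) : ℝ) ≤ n := by
      exact_mod_cast hcard y
    linarith
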